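/- arXiv:2012.09768 — 5 statements merged into one kernel-verified Lean document; each statement's English description precedes it below -/
import Mathlib

section
/- Let z₁,…,z_m ∈ ℝⁿ be such that Σ = (1/m)·Σ_{i=1}^m zᵢzᵢᵀ is positive definite, let V be a matrix with Σ = V·Vᵀ, and let Ẑ be the transformed sensing map Ẑ_i(Y) = (V⁻¹zᵢ)ᵀ Y (V⁻¹zᵢ). Then for any b ∈ ℝ^m and η ∈ ℝ^m, every positive semidefinite matrix Y ∈ ℝ^{n×n} with ‖Ẑ(Y) − b‖₁ ≤ ‖η‖₁ satisfies (Σ_{i=1}^m b_i − ‖η‖₁)/m ≤ ‖Y‖_* ≤ (Σ_{i=1}^m b_i + ‖η‖₁)/m. -/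
open MeasureTheory Matrix

noncomputable section

/-- The ℓ¹-norm of a vector. -/
def l1Norm {m : ℕ} (v : Fin m → ℝ) : ℝ := ∑ i, |v i|

/-- The Frobenius norm of a square real matrix. -/
def frobNorm {n : ℕ} (A : Matrix (Fin n) (Fin n) ℝ) : ℝ :=
  Real.sqrt (∑ i, ∑ j, (A i j) ^ 2)

/-- The rank-one sensing map `Z_i(X) = zᵢᵀ X zᵢ`. -/
def sensing {n m : ℕ} (z : Fin m → Fin n → ℝ) (X : Matrix (Fin n) (Fin n) ℝ) :
    Fin m → ℝ := fun i => z i ⬝ᵥ X.mulVec (z i)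

/-- The singular values of a square real matrix (unordered), as square roots of the
eigenvalues of `A * Aᴴ`. -/
def singVal {n : ℕ} (A : Matrix (Fin n) (Fin n) ℝ) (i : Fin n) : ℝ :=
  Real.sqrt ((Matrix.isHermitian_mul_conjTranspose_self A).eigenvalues i)

/-- Sum of the `p` smallest singular values of `A`, i.e. `‖[A]_{-p}‖_*`. -/
def sumSmallestSingVals {n : ℕ} (A : Matrix (Fin n) (Fin n) ℝ) (p : ℕ) : ℝ :=
  sInf {t | ∃ s : Finset (Fin n), s.card = p ∧ t = ∑ i ∈ s, singVal A i}

/-- The nuclear norm of a square real matrix: sum of its singular values. -/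
def nucNorm {n : ℕ} (A : Matrix (Fin n) (Fin n) ℝ) : ℝ := ∑ i, singVal A i

/-- The largest singular value of a square real matrix. -/
def sigmaMax {n : ℕ} (A : Matrix (Fin n) (Fin n) ℝ) : ℝ :=
  Real.sqrt (⨆ i, (Matrix.isHermitian_mul_conjTranspose_self A).eigenvalues i)

/-- The smallest singular value of a square real matrix. -/
def sigmaMin {n : ℕ} (A : Matrix (Fin n) (Fin n) ℝ) : ℝ :=
  Real.sqrt (⨅ i, (Matrix.isHermitian_mul_conjTranspose_self A).eigenvalues i)

/-- `μ` is the uniform distribution on the unit sphere of ℝⁿ: a probability measure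
supported on the unit sphere and invariant under orthogonal transformations. -/
def IsUniformOnSphere {n : ℕ} (μ : Measure (Fin n → ℝ)) : Prop :=
  IsProbabilityMeasure μ ∧ μ {z | ∑ i, (z i) ^ 2 = 1} = 1 ∧
    ∀ U : Matrix (Fin n) (Fin n) ℝ, Uᵀ * U = 1 → μ.map (U.mulVec) = μ

/-- The sample second-moment matrix `Σ = (1/m) ∑ zᵢ zᵢᵀ`. -/
def covM {n m : ℕ} (z : Fin m → Fin n → ℝ) : Matrix (Fin n) (Fin n) ℝ :=
  (m : ℝ)⁻¹ • ∑ i, vecMulVec (z i) (z i)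

/-- The induced asymmetric sensing map `Z'_i(X) = ½ (Z_{2i-1}(X) - Z_{2i}(X))`. -/
def sensingAsym {n m : ℕ} (z : Fin m → Fin n → ℝ) (X : Matrix (Fin n) (Fin n) ℝ) :
    Fin (m / 2) → ℝ := fun i =>
  (sensing z X ⟨2 * i, by have := i.2; omega⟩ - sensing z X ⟨2 * i + 1, by have := i.2; omega⟩) / 2

/-- The Symmetrized Restricted Uniform Boundedness property of order `R` with
constants `C₁, C₂` for the sensing vectors `z`. -/
def HasSRUB {n m : ℕ} (z : Fin m → Fin n → ℝ) (R : ℕ) (C₁ C₂ : ℝ) : Prop :=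
  ∀ X : Matrix (Fin n) (Fin n) ℝ, X.IsHermitian → X ≠ 0 → X.rank ≤ R →
    C₁ ≤ l1Norm (sensingAsym z X) / ((m / 2 : ℕ) : ℝ) / frobNorm X ∧
    l1Norm (sensingAsym z X) / ((m / 2 : ℕ) : ℝ) / frobNorm X ≤ C₂

/-- The nuclear norm of a positive semidefinite matrix equals its trace. -/
lemma nucNorm_eq_trace {n : ℕ} {Y : Matrix (Fin n) (Fin n) ℝ} (hY : Y.PosSemidef) :
    nucNorm Y = Y.trace := by
  have hsq : Y * Yᴴ = cfc (fun x : ℝ => x ^ 2) Y := by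
    rw [cfc_pow_id Y 2 hY.isHermitian.isSelfAdjoint, hY.isHermitian.eq, sq]
  have hroots : Finset.univ.val.map (isHermitian_mul_conjTranspose_self Y).eigenvalues =
      Finset.univ.val.map (fun i => hY.isHermitian.eigenvalues i ^ 2) := by
    have hroots_sq : (Y * Yᴴ).charpoly.roots =
        Finset.univ.val.map (fun i => hY.isHermitian.eigenvalues i ^ 2) := by
      rw [hsq, hY.isHermitian.charpoly_cfc_eq, Polynomial.roots_prod _ _
        (Finset.prod_ne_zero_iff.mpr fun i _ => Polynomial.X_sub_C_ne_zero _)]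
      simp only [Polynomial.roots_X_sub_C, Multiset.bind_singleton, RCLike.ofReal_real_eq_id,
        id_eq]
    exact (isHermitian_mul_conjTranspose_self Y).roots_charpoly_eq_eigenvalues.symm.trans
      hroots_sq
  have hsum := congrArg (fun s => (s.map Real.sqrt).sum) hroots
  simp only [Multiset.map_map, Function.comp_def] at hsum
  rw [hY.isHermitian.trace_eq_sum_eigenvalues]
  refine hsum.trans (Finset.sum_congr rfl fun i _ => ?_)
  exact Real.sqrt_sq (hY.eigenvalues_nonneg i)

/-- The sum of the rank-one measurements of `Y` is a trace against the sum of the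
rank-one sensing matrices. -/
lemma sum_sensing_eq_trace {n m : ℕ} (w : Fin m → Fin n → ℝ) (Y : Matrix (Fin n) (Fin n) ℝ) :
    ∑ i, sensing w Y i = (Y * ∑ i, vecMulVec (w i) (w i)).trace := by
  simp [sensing, Finset.mul_sum, trace_sum, mul_vecMulVec, trace_vecMulVec, dotProduct_comm]

/-- Sensing vectors whitened by a factor `V` of their second-moment matrix are isotropic. -/
lemma sum_vecMulVec_whitened {n m : ℕ} {z : Fin m → Fin n → ℝ} (hm : m ≠ 0)
    (hSigma : (covM z).PosDef) {V : Matrix (Fin n) (Fin n) ℝ} (hV : V * Vᵀ = covM z) :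
    ∑ i, vecMulVec (V⁻¹ *ᵥ z i) (V⁻¹ *ᵥ z i) = (m : ℝ) • (1 : Matrix (Fin n) (Fin n) ℝ) := by
  have hdet : IsUnit V.det := by
    have h := hSigma.det_pos.ne'
    rw [← hV, det_mul] at h
    exact (left_ne_zero_of_mul h).isUnit
  have hsum : ∑ i, vecMulVec (z i) (z i) = (m : ℝ) • (V * Vᵀ) := by
    rw [hV, covM, smul_inv_smul₀ (Nat.cast_ne_zero.mpr hm)]
  calc ∑ i, vecMulVec (V⁻¹ *ᵥ z i) (V⁻¹ *ᵥ z i)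
      = V⁻¹ * (∑ i, vecMulVec (z i) (z i)) * V⁻¹ᵀ := by
        simp [Finset.mul_sum, Finset.sum_mul, mul_vecMulVec, vecMulVec_mul, vecMul_transpose]
    _ = (m : ℝ) • ((V⁻¹ * V) * (V⁻¹ * V)ᵀ) := by
        rw [hsum, transpose_mul]
        simp only [Matrix.mul_smul, Matrix.smul_mul, Matrix.mul_assoc]
    _ = (m : ℝ) • 1 := by simp [nonsing_inv_mul V hdet]

/-- the nuclear norm is approximately flat over the transformed feasible set. -/
theorem fixed_trace {n m : ℕ} (z : Fin m → Fin n → ℝ)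
    (hSigma : (covM z).PosDef)
    (V : Matrix (Fin n) (Fin n) ℝ) (hV : V * Vᵀ = covM z)
    (b η : Fin m → ℝ) (Y : Matrix (Fin n) (Fin n) ℝ) (hY : Y.PosSemidef)
    (hfeas : l1Norm (fun i => sensing (fun j => V⁻¹.mulVec (z j)) Y i - b i) ≤ l1Norm η) :
    ((∑ i, b i) - l1Norm η) / m ≤ nucNorm Y ∧
      nucNorm Y ≤ ((∑ i, b i) + l1Norm η) / m := by
  rw [nucNorm_eq_trace hY]
  rcases Nat.eq_zero_or_pos m with rfl | hm
  · have hn : IsEmpty (Fin n) := by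
      by_contra hne
      rw [not_isEmpty_iff] at hne
      have h := hSigma.trace_pos
      simp [covM] at h
    simp [Matrix.trace]
  have hsum : ∑ i, sensing (fun j => V⁻¹.mulVec (z j)) Y i = m * Y.trace := by
    rw [sum_sensing_eq_trace, sum_vecMulVec_whitened hm.ne' hSigma hV]
    simp
  have habs : |m * Y.trace - ∑ i, b i| ≤ l1Norm η := by
    rw [← hsum, ← Finset.sum_sub_distrib]
    exact (Finset.abs_sum_le_sum_abs _ _).trans hfeas
  have hm' : (0 : ℝ) < m := Nat.cast_pos.mpr hm
  rw [div_le_iff₀ hm', le_div_iff₀ hm']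
  constructor <;> linarith [abs_le.mp habs]

end
end

section
/- Let X₀ ∈ ℝ^{n×n} be positive semidefinite, let V ∈ ℝ^{n×n} be invertible, and set Y₀ = Vᵀ X₀ V and Σ = V·Vᵀ. Then for every 0 ≤ r ≤ n, the sum of the n − r smallest eigenvalues of Y₀ is at most σ_max(Σ) times the sum of the n − r smallest eigenvalues of X₀; that is, ‖[Y₀]_{−(n−r)}‖_* ≤ σ_max(Σ)·‖[X₀]_{−(n−r)}‖_*. -/
open MeasureTheory Matrix

noncomputable section

/-- Among all weights in `[0, 1]` of total mass `p`, a sum of `p` of the values `f i` minimizes the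
weighted sum. -/
theorem exists_card_eq_sum_le_sum_mul {ι : Type*} [Fintype ι] [DecidableEq ι] (f w : ι → ℝ)
    (hw₀ : ∀ i, 0 ≤ w i) (hw₁ : ∀ i, w i ≤ 1) {p : ℕ} (hw : ∑ i, w i = p) :
    ∃ s : Finset ι, s.card = p ∧ ∑ i ∈ s, f i ≤ ∑ i, f i * w i := by
  have hp : p ≤ Fintype.card ι := by
    have h : ∑ i, w i ≤ ∑ _i : ι, (1 : ℝ) := Finset.sum_le_sum fun i _ => hw₁ i
    rw [hw] at h
    simpa using h
  obtain ⟨s, hs, hmin⟩ := Finset.exists_min_image (Finset.powersetCard p Finset.univ)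
    (fun s => ∑ i ∈ s, f i) (Finset.powersetCard_nonempty.2 hp)
  have hcard : s.card = p := (Finset.mem_powersetCard.1 hs).2
  have hswap : ∀ i ∈ s, ∀ j ∉ s, f i ≤ f j := by
    intro i hi j hj
    have hj' : j ∉ s.erase i := fun h => hj (Finset.mem_of_mem_erase h)
    have h := hmin (insert j (s.erase i)) (Finset.mem_powersetCard.2
      ⟨Finset.subset_univ _, by
        rw [Finset.card_insert_of_notMem hj', Finset.card_erase_add_one hi, hcard]⟩)
    simp only [Finset.sum_insert hj'] at h
    have := Finset.add_sum_erase s f hi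
    linarith
  obtain ⟨c, hc₁, hc₂⟩ : ∃ c, (∀ i ∈ s, f i ≤ c) ∧ ∀ j ∉ s, c ≤ f j := by
    rcases s.eq_empty_or_nonempty with rfl | hne
    · obtain ⟨c, hc⟩ := (Set.finite_range f).bddBelow
      exact ⟨c, by simp, fun j _ => hc ⟨j, rfl⟩⟩
    · obtain ⟨k, hk, hmax⟩ := s.exists_max_image f hne
      exact ⟨f k, hmax, fun j hj => hswap k hk j hj⟩
  refine ⟨s, hcard, ?_⟩
  have hterm : ∀ i, 0 ≤ (f i - c) * (w i - if i ∈ s then 1 else 0) := by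
    intro i
    split_ifs with hi
    · exact mul_nonneg_of_nonpos_of_nonpos (sub_nonpos.2 (hc₁ i hi)) (sub_nonpos.2 (hw₁ i))
    · rw [sub_zero]
      exact mul_nonneg (sub_nonneg.2 (hc₂ i hi)) (hw₀ i)
  have h := Finset.sum_nonneg fun i (_ : i ∈ Finset.univ) => hterm i
  simp only [sub_mul, mul_sub, Finset.sum_sub_distrib, ← Finset.mul_sum, hw, mul_ite, mul_one,
    mul_zero, Finset.sum_ite_mem, Finset.univ_inter, Finset.sum_const, hcard, nsmul_eq_mul] at h
  linarith

theorem singVal_nonneg {n : ℕ} (A : Matrix (Fin n) (Fin n) ℝ) (i : Fin n) : 0 ≤ singVal A i :=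
  Real.sqrt_nonneg _

theorem singVal_le_sigmaMax {n : ℕ} (A : Matrix (Fin n) (Fin n) ℝ) (i : Fin n) :
    singVal A i ≤ sigmaMax A :=
  Real.sqrt_le_sqrt (le_ciSup (Set.finite_range _).bddAbove i)

/-- `AᵀA` and `AAᵀ` have the same singular values. -/
theorem singVal_transpose_mul_self {n : ℕ} (A : Matrix (Fin n) (Fin n) ℝ) :
    singVal (Aᵀ * A) = singVal (A * Aᵀ) := by
  have h : (Matrix.isHermitian_mul_conjTranspose_self (Aᵀ * A)).eigenvalues =
      (Matrix.isHermitian_mul_conjTranspose_self (A * Aᵀ)).eigenvalues := by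
    rw [Matrix.IsHermitian.eigenvalues_eq_eigenvalues_iff]
    simp only [conjTranspose_eq_transpose_of_trivial, transpose_mul, transpose_transpose]
    rw [Matrix.mul_assoc, Matrix.charpoly_mul_comm]
    simp only [Matrix.mul_assoc]
  funext i
  simp only [singVal, h]

theorem sumSmallestSingVals_transpose_mul_self {n : ℕ} (A : Matrix (Fin n) (Fin n) ℝ) (p : ℕ) :
    sumSmallestSingVals (Aᵀ * A) p = sumSmallestSingVals (A * Aᵀ) p := by
  simp only [sumSmallestSingVals, singVal_transpose_mul_self]

theorem sumSmallestSingVals_le_sum {n : ℕ} (A : Matrix (Fin n) (Fin n) ℝ) (s : Finset (Fin n)) :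
    sumSmallestSingVals A s.card ≤ ∑ i ∈ s, singVal A i := by
  refine csInf_le ⟨0, ?_⟩ ⟨s, rfl, rfl⟩
  rintro _ ⟨t, -, rfl⟩
  exact Finset.sum_nonneg fun i _ => singVal_nonneg A i

theorem exists_sumSmallestSingVals_eq {n : ℕ} (A : Matrix (Fin n) (Fin n) ℝ) {p : ℕ}
    (hp : p ≤ n) :
    ∃ s : Finset (Fin n), s.card = p ∧ sumSmallestSingVals A p = ∑ i ∈ s, singVal A i := by
  refine Set.Nonempty.csInf_mem
    (s := {t | ∃ s : Finset (Fin n), s.card = p ∧ t = ∑ i ∈ s, singVal A i}) ?_ ?_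
  · obtain ⟨s, -, hs⟩ := Finset.exists_subset_card_eq (s := (Finset.univ : Finset (Fin n)))
      (by simpa using hp)
    exact ⟨_, s, hs, rfl⟩
  · refine (Set.finite_range fun s : Finset (Fin n) => ∑ i ∈ s, singVal A i).subset ?_
    rintro _ ⟨s, -, rfl⟩
    exact ⟨s, rfl⟩

/-- The singular values of a positive semidefinite matrix are its eigenvalues for some orthonormal
eigenbasis. -/
theorem exists_orthonormalBasis_singVal {n : ℕ} {Z : Matrix (Fin n) (Fin n) ℝ}
    (hZ : Z.PosSemidef) :
    ∃ b : OrthonormalBasis (Fin n) ℝ (EuclideanSpace ℝ (Fin n)),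
      ∀ i, Z.toEuclideanLin (b i) = singVal Z i • b i := by
  set T := Z.toEuclideanLin with hT
  have hpos : T.IsPositive := Matrix.isPositive_toEuclideanLin_iff.2 hZ
  set hH := Matrix.isHermitian_mul_conjTranspose_self Z
  refine ⟨hH.eigenvectorBasis, fun i => ?_⟩
  set v := hH.eigenvectorBasis i
  have hsq : T (T v) = singVal Z i ^ 2 • v := by
    have h : (Z * Zᴴ) *ᵥ v.ofLp = hH.eigenvalues i • v.ofLp := hH.mulVec_eigenvectorBasis i
    rw [singVal, Real.sq_sqrt ((posSemidef_self_mul_conjTranspose Z).eigenvalues_nonneg i)]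
    apply WithLp.ofLp_injective
    rw [← Matrix.mulVec_mulVec, show Zᴴ *ᵥ v.ofLp = Z *ᵥ v.ofLp by rw [hZ.isHermitian.eq]] at h
    simpa [hT] using h
  set s := singVal Z i
  have hs : 0 ≤ s := singVal_nonneg Z i
  set w := T v - s • v with hw
  have hTw : T w = -(s • w) := by
    rw [hw, map_sub, map_smul, hsq]
    module
  have hww : inner ℝ w w = (0 : ℝ) := by
    rcases hs.eq_or_lt with h0 | h0
    · have hwv : w = T v := by rw [hw, ← h0, zero_smul, sub_zero]
      rw [hwv, hpos.isSymmetric, hsq, ← h0]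
      simp
    · have h := hpos.re_inner_nonneg_left w
      rw [hTw, inner_neg_left, real_inner_smul_left] at h
      have hn : (0 : ℝ) ≤ inner ℝ w w := real_inner_self_nonneg
      simp only [RCLike.re_to_real] at h
      nlinarith
  exact sub_eq_zero.1 (inner_self_eq_zero.1 hww)

/-- A quadratic form expanded in an orthonormal eigenbasis. -/
theorem inner_toEuclideanLin_eq_sum {n : ℕ} {Z : Matrix (Fin n) (Fin n) ℝ} (hZ : Z.IsHermitian)
    {b : OrthonormalBasis (Fin n) ℝ (EuclideanSpace ℝ (Fin n))} {d : Fin n → ℝ}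
    (hb : ∀ i, Z.toEuclideanLin (b i) = d i • b i) (x : EuclideanSpace ℝ (Fin n)) :
    inner ℝ x (Z.toEuclideanLin x) = ∑ i, d i * inner ℝ (b i) x ^ 2 := by
  rw [← b.sum_inner_mul_inner]
  refine Finset.sum_congr rfl fun i _ => ?_
  rw [← Matrix.isSymmetric_toEuclideanLin_iff.2 hZ (b i) x, hb, real_inner_smul_left,
    real_inner_comm x]
  ring

theorem sum_inner_sq_eq {n : ℕ} (b : OrthonormalBasis (Fin n) ℝ (EuclideanSpace ℝ (Fin n)))
    (x : EuclideanSpace ℝ (Fin n)) : ∑ i, inner ℝ (b i) x ^ 2 = inner ℝ x x := by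
  rw [real_inner_self_eq_norm_sq, ← b.sum_sq_norm_inner_right]
  simp

theorem inner_toEuclideanLin_le_sigmaMax {n : ℕ} {Z : Matrix (Fin n) (Fin n) ℝ}
    (hZ : Z.PosSemidef) (x : EuclideanSpace ℝ (Fin n)) :
    inner ℝ x (Z.toEuclideanLin x) ≤ sigmaMax Z * inner ℝ x x := by
  obtain ⟨b, hb⟩ := exists_orthonormalBasis_singVal hZ
  rw [inner_toEuclideanLin_eq_sum hZ.isHermitian hb, ← sum_inner_sq_eq b, Finset.mul_sum]
  exact Finset.sum_le_sum fun i _ =>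
    mul_le_mul_of_nonneg_right (singVal_le_sigmaMax Z i) (sq_nonneg _)

/-- Ky Fan's minimum principle: the sum of the smallest eigenvalues is at most the trace of the
compression to any coordinate subspace of an orthonormal basis. -/
theorem sumSmallestSingVals_le_sum_inner {n : ℕ} {Z : Matrix (Fin n) (Fin n) ℝ}
    (hZ : Z.PosSemidef) (c : OrthonormalBasis (Fin n) ℝ (EuclideanSpace ℝ (Fin n)))
    (t : Finset (Fin n)) :
    sumSmallestSingVals Z t.card ≤ ∑ j ∈ t, inner ℝ (c j) (Z.toEuclideanLin (c j)) := by
  obtain ⟨b, hb⟩ := exists_orthonormalBasis_singVal hZ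
  have hunit : ∀ (e : OrthonormalBasis (Fin n) ℝ (EuclideanSpace ℝ (Fin n))) i,
      inner ℝ (e i) (e i) = (1 : ℝ) := fun e i => by
    rw [real_inner_self_eq_norm_sq, e.orthonormal.1 i, one_pow]
  obtain ⟨s, hs, hle⟩ := exists_card_eq_sum_le_sum_mul (singVal Z)
    (fun i => ∑ j ∈ t, inner ℝ (b i) (c j) ^ 2) (fun i => Finset.sum_nonneg fun j _ => sq_nonneg _)
    (fun i => by
      rw [← hunit b i, ← sum_inner_sq_eq c]
      simp only [real_inner_comm (b i)]
      exact Finset.sum_le_sum_of_subset_of_nonneg (Finset.subset_univ t)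
        fun j _ _ => sq_nonneg _)
    (p := t.card) (by
      rw [Finset.sum_comm]
      simp [sum_inner_sq_eq])
  rw [← hs]
  refine (sumSmallestSingVals_le_sum Z s).trans (hle.trans_eq ?_)
  simp only [inner_toEuclideanLin_eq_sum hZ.isHermitian hb, Finset.mul_sum]
  exact Finset.sum_comm

theorem inner_toEuclideanLin_mul_mul_transpose {n : ℕ} (A S : Matrix (Fin n) (Fin n) ℝ)
    (x : EuclideanSpace ℝ (Fin n)) :
    inner ℝ x ((A * S * Aᵀ).toEuclideanLin x) =
      inner ℝ (Aᵀ.toEuclideanLin x) (S.toEuclideanLin (Aᵀ.toEuclideanLin x)) := by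
  rw [← conjTranspose_eq_transpose_of_trivial A, Matrix.toEuclideanLin_conjTranspose_eq_adjoint,
    LinearMap.adjoint_inner_left, ← Matrix.toEuclideanLin_conjTranspose_eq_adjoint]
  congr 1
  apply WithLp.ofLp_injective
  simp [Matrix.mulVec_mulVec, Matrix.mul_assoc]

/-- the sum of the `n - r` smallest eigenvalues of `Y₀ = Vᵀ X₀ V` is at most
`σ_max(VVᵀ)` times that of `X₀`. -/
theorem lower_nuclear_bound {n : ℕ} (X₀ V : Matrix (Fin n) (Fin n) ℝ)
    (hX₀ : X₀.PosSemidef) (hV : IsUnit V.det) (r : ℕ) (hr : r ≤ n) :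
    sumSmallestSingVals (Vᵀ * X₀ * V) (n - r) ≤
      sigmaMax (V * Vᵀ) * sumSmallestSingVals X₀ (n - r) := by
  obtain ⟨A, rfl⟩ : ∃ A : Matrix (Fin n) (Fin n) ℝ, X₀ = Aᵀ * A := by
    open scoped MatrixOrder Matrix.Norms.L2Operator in
    exact CStarAlgebra.nonneg_iff_eq_star_mul_self.mp hX₀.nonneg
  have hS : (V * Vᵀ).PosSemidef := posSemidef_self_mul_conjTranspose V
  have hN : (A * Aᵀ).PosSemidef := posSemidef_self_mul_conjTranspose A
  have hM : (A * (V * Vᵀ) * Aᵀ).PosSemidef := hS.mul_mul_conjTranspose_same A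
  have hY : Vᵀ * (Aᵀ * A) * V = (A * V)ᵀ * (A * V) := by
    simp only [transpose_mul, Matrix.mul_assoc]
  have hYM : A * V * (A * V)ᵀ = A * (V * Vᵀ) * Aᵀ := by
    simp only [transpose_mul, Matrix.mul_assoc]
  rw [hY, sumSmallestSingVals_transpose_mul_self, hYM, sumSmallestSingVals_transpose_mul_self]
  obtain ⟨c, hc⟩ := exists_orthonormalBasis_singVal hN
  obtain ⟨t, ht, hsum⟩ := exists_sumSmallestSingVals_eq (A * Aᵀ) (Nat.sub_le n r)
  rw [hsum, ← ht, Finset.mul_sum]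
  refine (sumSmallestSingVals_le_sum_inner hM c t).trans (Finset.sum_le_sum fun j _ => ?_)
  have hnorm : inner ℝ (Aᵀ.toEuclideanLin (c j)) (Aᵀ.toEuclideanLin (c j)) =
      singVal (A * Aᵀ) j := by
    have h := inner_toEuclideanLin_mul_mul_transpose A 1 (c j)
    rw [Matrix.mul_one, hc, real_inner_smul_right, real_inner_self_eq_norm_sq,
      c.orthonormal.1 j] at h
    simpa using h.symm
  rw [inner_toEuclideanLin_mul_mul_transpose, ← hnorm]
  exact inner_toEuclideanLin_le_sigmaMax hS _

end
end

section
/- Let A ∈ ℂ^{n×n}, B ∈ ℂ^{n×m}, let 1 ≤ i₁ < i₂ < … < i_k ≤ n be indices, and let p > 0 be a real number. Denoting by σ_1(M) ≥ σ_2(M) ≥ … the singular values of a matrix M in nonincreasing order, it holds that Σ_{t=1}^k σ_{i_t}^p(A·B) ≥ Σ_{t=1}^k σ_{i_t}^p(A)·σ_{n−t+1}^p(B). -/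
open Matrix

noncomputable section

/-- The `j`-th singular value, in nonincreasing order (`j = 0` gives the largest),
of a complex matrix `M` with `n` rows: the square roots of the eigenvalues of `M Mᴴ`,
arranged in nonincreasing order. -/
def singValDesc {n m : ℕ} (M : Matrix (Fin n) (Fin m) ℂ) (j : Fin n) : ℝ :=
  Real.sqrt ((Matrix.isHermitian_mul_conjTranspose_self M).eigenvalues
    (Tuple.sort (Matrix.isHermitian_mul_conjTranspose_self M).eigenvalues (Fin.rev j)))

section Scalar

open MeasureTheory Set

theorem integrableOn_rpow_mul_log_max_one_inv {p : ℝ} (hp : 0 < p) :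
    IntegrableOn (fun s : ℝ => s ^ (p - 1) * Real.log (max 1 s⁻¹)) (Ioi 0) := by
  have h1 : IntegrableOn (fun s : ℝ => s ^ (p - 1) * Real.log (max 1 s⁻¹)) (Ioc 0 1) := by
    have h2 : IntegrableOn (fun s : ℝ => (2 / p) * s ^ (p / 2 - 1)) (Ioc 0 1) := by
      refine Integrable.const_mul ?_ _
      exact (intervalIntegrable_iff_integrableOn_Ioc_of_le zero_le_one).1
        (intervalIntegral.intervalIntegrable_rpow' (by linarith))
    refine Integrable.mono' h2 (by fun_prop) ?_
    refine (ae_restrict_iff' measurableSet_Ioc).2 (Filter.Eventually.of_forall fun s hs => ?_)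
    have hs0 : 0 < s := hs.1
    have hs1 : 1 ≤ s⁻¹ := (one_le_inv₀ hs0).2 hs.2
    have hlog : Real.log s⁻¹ ≤ s⁻¹ ^ (p / 2) / (p / 2) :=
      Real.log_le_rpow_div (by positivity) (by positivity)
    rw [max_eq_right hs1, Real.norm_of_nonneg
      (mul_nonneg (Real.rpow_nonneg hs0.le _) (Real.log_nonneg hs1))]
    calc s ^ (p - 1) * Real.log s⁻¹ ≤ s ^ (p - 1) * (s⁻¹ ^ (p / 2) / (p / 2)) := by gcongr
      _ = (2 / p) * (s ^ (p - 1) * s ^ (-(p / 2))) := by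
        rw [Real.inv_rpow hs0.le, Real.rpow_neg hs0.le]; field_simp
      _ = (2 / p) * s ^ (p / 2 - 1) := by rw [← Real.rpow_add hs0]; ring_nf
  have h3 : IntegrableOn (fun s : ℝ => s ^ (p - 1) * Real.log (max 1 s⁻¹)) (Ioi 1) := by
    refine integrableOn_zero.congr_fun (fun s hs => ?_) measurableSet_Ioi
    have h4 : max 1 s⁻¹ = 1 := max_eq_left (inv_le_one_of_one_le₀ (le_of_lt (mem_Ioi.1 hs)))
    simp [h4]
  rw [← Ioc_union_Ioi_eq_Ioi zero_le_one]
  exact h1.union h3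

theorem integral_rpow_mul_log_max_one_inv_pos {p : ℝ} (hp : 0 < p) :
    0 < ∫ s in Ioi (0 : ℝ), s ^ (p - 1) * Real.log (max 1 s⁻¹) := by
  have hnn : ∀ s ∈ Ioi (0 : ℝ), 0 ≤ s ^ (p - 1) * Real.log (max 1 s⁻¹) := fun s hs =>
    mul_nonneg (Real.rpow_nonneg (le_of_lt hs) _) (Real.log_nonneg (le_max_left _ _))
  rw [setIntegral_pos_iff_support_of_nonneg_ae
    ((ae_restrict_iff' measurableSet_Ioi).2 (Filter.Eventually.of_forall hnn))
    (integrableOn_rpow_mul_log_max_one_inv hp)]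
  refine lt_of_lt_of_le (b := volume (Ioo (0 : ℝ) 1)) (by simp) (measure_mono fun s hs => ?_)
  refine ⟨?_, hs.1⟩
  have h1 : 1 < s⁻¹ := (one_lt_inv₀ hs.1).2 hs.2
  rw [Function.mem_support, max_eq_right h1.le]
  exact (mul_pos (Real.rpow_pos_of_pos hs.1 _) (Real.log_pos h1)).ne'

theorem integral_rpow_mul_log_max_one_div {p u : ℝ} (hp : 0 < p) (hu : 0 ≤ u) :
    IntegrableOn (fun s : ℝ => s ^ (p - 1) * Real.log (max 1 (u / s))) (Ioi 0) ∧
    ∫ s in Ioi (0 : ℝ), s ^ (p - 1) * Real.log (max 1 (u / s)) =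
      u ^ p * ∫ s in Ioi (0 : ℝ), s ^ (p - 1) * Real.log (max 1 s⁻¹) := by
  rcases hu.eq_or_lt with rfl | hu
  · simp [Real.zero_rpow hp.ne']
  have key : EqOn (fun s : ℝ => (u * s) ^ (p - 1) * Real.log (max 1 (u / (u * s))))
      (fun s : ℝ => u ^ (p - 1) * (s ^ (p - 1) * Real.log (max 1 s⁻¹))) (Ioi 0) := by
    intro s hs
    have hs : 0 < s := hs
    have : u / (u * s) = s⁻¹ := by field_simp
    simp only [this, Real.mul_rpow hu.le hs.le]
    ring
  constructor
  · have := (integrableOn_Ioi_comp_mul_left_iff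
      (fun s : ℝ => s ^ (p - 1) * Real.log (max 1 (u / s))) 0 hu).1
    rw [mul_zero] at this
    refine this ?_
    exact IntegrableOn.congr_fun ((integrableOn_rpow_mul_log_max_one_inv hp).const_mul _) key.symm
      measurableSet_Ioi
  · have := integral_comp_mul_left_Ioi'
      (fun s : ℝ => s ^ (p - 1) * Real.log (max 1 (u / s))) 0 hu
    rw [mul_zero] at this
    rw [← this, setIntegral_congr_fun measurableSet_Ioi key, integral_const_mul, smul_eq_mul,
      ← mul_assoc, mul_comm u, ← Real.rpow_add_one hu.ne', sub_add_cancel]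

theorem sum_rpow_le_sum_rpow_of_prod_max_le {ι : Type*} [Fintype ι] {u z : ι → ℝ}
    (hu : ∀ i, 0 ≤ u i) (hz : ∀ i, 0 ≤ z i)
    (h : ∀ θ : ℝ, 0 < θ → ∏ i, max θ (u i) ≤ ∏ i, max θ (z i)) {p : ℝ} (hp : 0 < p) :
    ∑ i, u i ^ p ≤ ∑ i, z i ^ p := by
  refine le_of_mul_le_mul_right ?_ (integral_rpow_mul_log_max_one_inv_pos hp)
  rw [Finset.sum_mul, Finset.sum_mul]
  simp only [← (integral_rpow_mul_log_max_one_div hp (hu _)).2,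
    ← (integral_rpow_mul_log_max_one_div hp (hz _)).2]
  rw [← integral_finsetSum _ fun i _ => (integral_rpow_mul_log_max_one_div hp (hu i)).1,
    ← integral_finsetSum _ fun i _ => (integral_rpow_mul_log_max_one_div hp (hz i)).1]
  refine setIntegral_mono_on
    (integrable_finsetSum _ fun i _ => (integral_rpow_mul_log_max_one_div hp (hu i)).1)
    (integrable_finsetSum _ fun i _ => (integral_rpow_mul_log_max_one_div hp (hz i)).1)
    measurableSet_Ioi fun θ hθ => ?_
  have hθ : 0 < θ := hθ
  have hmax : ∀ a : ℝ, max 1 (a / θ) = max θ a / θ := fun a => by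
    rw [← max_div_div_right hθ.le, div_self hθ.ne']
  have hpos : ∀ a : ℝ, 0 < max 1 (a / θ) := fun a => lt_max_of_lt_left one_pos
  rw [← Finset.mul_sum, ← Finset.mul_sum, ← Real.log_prod fun i _ => (hpos _).ne',
    ← Real.log_prod fun i _ => (hpos _).ne']
  refine mul_le_mul_of_nonneg_left (Real.log_le_log (Finset.prod_pos fun i _ => hpos _) ?_)
    (Real.rpow_nonneg hθ.le _)
  simp only [hmax, Finset.prod_div_distrib]
  exact div_le_div_of_nonneg_right (h θ hθ) (by positivity)

end Scalar

open Module InnerProductSpace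

theorem det_eq_prod_of_apply_basis {E ι : Type*} [AddCommGroup E] [Module ℂ E] [Fintype ι]
    [DecidableEq ι] (b : Basis ι ℂ E) {T : E →ₗ[ℂ] E} {c : ι → ℝ}
    (hT : ∀ i, T (b i) = (c i : ℂ) • b i) : LinearMap.det T = ((∏ i, c i : ℝ) : ℂ) := by
  have : LinearMap.toMatrix b b T = Matrix.diagonal fun i => (c i : ℂ) := by
    ext i j
    rw [LinearMap.toMatrix_apply, hT, map_smul, b.repr_self, Finsupp.smul_apply,
      Finsupp.single_apply, Matrix.diagonal_apply, smul_eq_mul]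
    grind
  rw [← LinearMap.det_toMatrix b, this, Matrix.det_diagonal]
  push_cast
  rfl

theorem finrank_span_range_of_orthonormalBasis_mem {E ι κ : Type*} [NormedAddCommGroup E]
    [InnerProductSpace ℂ E] [Fintype ι] [Fintype κ]
    (e : OrthonormalBasis ι ℂ E) {X : Submodule ℂ E} {a : κ → ι} (ha : Function.Injective a)
    (hX : ∀ t, e (a t) ∈ X) :
    finrank ℂ (Submodule.span ℂ (Set.range fun t => (⟨e (a t), hX t⟩ : X))) = Fintype.card κ := by
  refine finrank_span_eq_card (LinearIndependent.of_comp X.subtype ?_)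
  exact e.orthonormal.linearIndependent.comp a ha

theorem inner_eq_zero_of_mem_span_range {E ι κ : Type*} [NormedAddCommGroup E]
    [InnerProductSpace ℂ E] [Fintype ι]
    (e : OrthonormalBasis ι ℂ E) {X : Submodule ℂ E} {a : κ → ι}
    (hX : ∀ t, e (a t) ∈ X) {x : X} {j : ι} (hj : ∀ t, a t ≠ j)
    (hx : x ∈ Submodule.span ℂ (Set.range fun t => (⟨e (a t), hX t⟩ : X))) :
    inner ℂ (e j) (x : E) = 0 := by
  have : Submodule.span ℂ (Set.range fun t => (⟨e (a t), hX t⟩ : X)) ≤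
      LinearMap.ker (innerₛₗ ℂ (e j) ∘ₗ X.subtype) := by
    rw [Submodule.span_le]
    rintro _ ⟨t, rfl⟩
    simp [e.inner_eq_zero (hj t).symm]
  exact this hx

section SingularSystem

variable {E F G : Type*} [NormedAddCommGroup E] [InnerProductSpace ℂ E] [FiniteDimensional ℂ E]
  [NormedAddCommGroup F] [InnerProductSpace ℂ F] [FiniteDimensional ℂ F]
  [NormedAddCommGroup G] [InnerProductSpace ℂ G] [FiniteDimensional ℂ G] {n : ℕ}

/-- The orthonormal basis `e` consists of right singular vectors of `S`, with singular values `σ`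
in nonincreasing order. -/
structure IsSingularSystem (S : E →ₗ[ℂ] F) (e : OrthonormalBasis (Fin n) ℂ E) (σ : Fin n → ℝ) :
    Prop where
  nonneg : ∀ i, 0 ≤ σ i
  antitone : Antitone σ
  adjoint_apply : ∀ i, LinearMap.adjoint S (S (e i)) = ((σ i ^ 2 : ℝ) : ℂ) • e i

theorem exists_isSingularSystem (S : E →ₗ[ℂ] F) (hn : finrank ℂ E = n) :
    ∃ e : OrthonormalBasis (Fin n) ℂ E, ∃ σ, IsSingularSystem S e σ := by
  have hP := S.isPositive_adjoint_comp_self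
  refine ⟨hP.isSymmetric.eigenvectorBasis hn, fun i => √(hP.isSymmetric.eigenvalues hn i),
    fun i => Real.sqrt_nonneg _,
    fun i j h => Real.sqrt_le_sqrt (hP.isSymmetric.eigenvalues_antitone hn h), fun i => ?_⟩
  rw [Real.sq_sqrt (hP.nonneg_eigenvalues hn i)]
  exact hP.isSymmetric.apply_eigenvectorBasis hn i

namespace IsSingularSystem

variable {S : E →ₗ[ℂ] F} {e : OrthonormalBasis (Fin n) ℂ E} {σ : Fin n → ℝ}

theorem norm_sq_apply (h : IsSingularSystem S e σ) (x : E) :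
    ‖S x‖ ^ 2 = ∑ i, σ i ^ 2 * ‖inner ℂ (e i) x‖ ^ 2 := by
  have h1 : ∀ i, inner ℂ (e i) (LinearMap.adjoint S (S x)) =
      ((σ i ^ 2 : ℝ) : ℂ) * inner ℂ (e i) x := by
    intro i
    rw [LinearMap.adjoint_inner_right, ← LinearMap.adjoint_inner_left, h.adjoint_apply,
      inner_smul_left, Complex.conj_ofReal]
  have h2 : ((‖S x‖ ^ 2 : ℝ) : ℂ) = ((∑ i, σ i ^ 2 * ‖inner ℂ (e i) x‖ ^ 2 : ℝ) : ℂ) := by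
    have h3 := inner_self_eq_norm_sq_to_K (𝕜 := ℂ) (S x)
    rw [← LinearMap.adjoint_inner_right, ← e.sum_inner_mul_inner] at h3
    push_cast
    refine h3.symm.trans (Finset.sum_congr rfl fun i _ => ?_)
    rw [h1, ← inner_conj_symm x (e i)]
    have := RCLike.conj_mul (inner ℂ (e i) x)
    simp only [RCLike.ofReal_eq_complex_ofReal] at this
    push_cast
    rw [← this]
    ring
  exact_mod_cast h2

theorem mul_norm_le (h : IsSingularSystem S e σ) (r : Fin n) {x : E}
    (hx : ∀ j, r < j → inner ℂ (e j) x = 0) : σ r * ‖x‖ ≤ ‖S x‖ := by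
  refine le_of_sq_le_sq ?_ (norm_nonneg _)
  rw [h.norm_sq_apply, mul_pow, ← e.sum_sq_norm_inner_right, Finset.mul_sum]
  refine Finset.sum_le_sum fun i _ => ?_
  by_cases hi : r < i
  · simp [hx i hi]
  · have := h.antitone (not_lt.1 hi)
    have := h.nonneg r
    gcongr

theorem norm_le_mul (h : IsSingularSystem S e σ) (r : Fin n) {x : E}
    (hx : ∀ j, j < r → inner ℂ (e j) x = 0) : ‖S x‖ ≤ σ r * ‖x‖ := by
  refine le_of_sq_le_sq ?_ (mul_nonneg (h.nonneg r) (norm_nonneg _))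
  rw [h.norm_sq_apply, mul_pow, ← e.sum_sq_norm_inner_right, Finset.mul_sum]
  refine Finset.sum_le_sum fun i _ => ?_
  by_cases hi : i < r
  · simp [hx i hi]
  · have := h.antitone (not_lt.1 hi)
    have := h.nonneg i
    gcongr

theorem det_adjoint_comp_self (h : IsSingularSystem S e σ) :
    LinearMap.det (LinearMap.adjoint S ∘ₗ S) = ((∏ i, σ i ^ 2 : ℝ) : ℂ) :=
  det_eq_prod_of_apply_basis e.toBasis fun i => by
    rw [e.coe_toBasis]
    exact h.adjoint_apply i

end IsSingularSystem

/-- A nonzero vector of `V` annihilated by fewer functionals than the dimension of `V`. -/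
theorem exists_mem_ne_zero_of_card_lt_finrank {ι : Type*} [Fintype ι] (V : Submodule ℂ E)
    (φ : ι → E →ₗ[ℂ] ℂ) (h : Fintype.card ι < finrank ℂ V) :
    ∃ x ∈ V, x ≠ 0 ∧ ∀ i, φ i x = 0 := by
  have := LinearMap.ker_ne_bot_of_finrank_lt (f := (LinearMap.pi φ).domRestrict V) (by simpa)
  obtain ⟨x, hx, hx0⟩ := Submodule.exists_mem_ne_zero_of_ne_bot this
  refine ⟨x, x.2, by simpa using hx0, fun i => ?_⟩
  exact congrFun (LinearMap.mem_ker.1 hx) i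

variable {S : E →ₗ[ℂ] F} {e : OrthonormalBasis (Fin n) ℂ E} {σ : Fin n → ℝ}

theorem IsSingularSystem.le_of_finrank (h : IsSingularSystem S e σ) (r : Fin n)
    (V : Submodule ℂ E) (hV : (r : ℕ) < finrank ℂ V) {c : ℝ}
    (hc : ∀ x ∈ V, c * ‖x‖ ≤ ‖S x‖) : c ≤ σ r := by
  obtain ⟨x, hxV, hx0, hx⟩ := exists_mem_ne_zero_of_card_lt_finrank V
    (fun j : Finset.Iio r => innerₛₗ ℂ (e j)) (by simpa only [Fintype.card_coe, Fin.card_Iio] using hV)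
  refine le_of_mul_le_mul_right ((hc x hxV).trans (h.norm_le_mul r fun j hj => ?_))
    (norm_pos_iff.2 hx0)
  exact hx ⟨j, Finset.mem_Iio.2 hj⟩

theorem IsSingularSystem.ge_of_finrank (h : IsSingularSystem S e σ) (r : Fin n)
    (V : Submodule ℂ E) (hV : n ≤ r + finrank ℂ V) {c : ℝ}
    (hc : ∀ x ∈ V, ‖S x‖ ≤ c * ‖x‖) : σ r ≤ c := by
  obtain ⟨x, hxV, hx0, hx⟩ := exists_mem_ne_zero_of_card_lt_finrank V
    (fun j : Finset.Ioi r => innerₛₗ ℂ (e j)) (by rw [Fintype.card_coe, Fin.card_Ioi]; omega)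
  refine le_of_mul_le_mul_right ((h.mul_norm_le r fun j hj => ?_).trans (hc x hxV))
    (norm_pos_iff.2 hx0)
  exact hx ⟨j, Finset.mem_Ioi.2 hj⟩

/-- The singular values of a linear map restricted along a contraction are not larger. -/
theorem IsSingularSystem.comp_contraction_le (h : IsSingularSystem S e σ) {M : E →ₗ[ℂ] E}
    (hM : ∀ x, ‖M x‖ ≤ ‖x‖) {f : OrthonormalBasis (Fin n) ℂ E} {τ : Fin n → ℝ}
    (h' : IsSingularSystem (S ∘ₗ M) f τ) (r : Fin n) : τ r ≤ σ r := by
  have hn : finrank ℂ E = n := by simpa using finrank_eq_card_basis e.toBasis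
  obtain ⟨x, -, hx0, hx⟩ := exists_mem_ne_zero_of_card_lt_finrank (⊤ : Submodule ℂ E)
    (Sum.elim (fun j : Finset.Ioi r => innerₛₗ ℂ (f j))
      (fun j : Finset.Iio r => innerₛₗ ℂ (e j) ∘ₗ M)) (by
      simp only [Fintype.card_sum, Fintype.card_coe, Fin.card_Ioi, Fin.card_Iio, finrank_top, hn]
      omega)
  refine le_of_mul_le_mul_right ?_ (norm_pos_iff.2 hx0)
  calc τ r * ‖x‖ ≤ ‖S (M x)‖ :=
        h'.mul_norm_le r fun j hj => hx (Sum.inl ⟨j, Finset.mem_Ioi.2 hj⟩)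
    _ ≤ σ r * ‖M x‖ := h.norm_le_mul r fun j hj => hx (Sum.inr ⟨j, Finset.mem_Iio.2 hj⟩)
    _ ≤ σ r * ‖x‖ := mul_le_mul_of_nonneg_left (hM x) (h.nonneg r)

/-- Weyl's inequality `σ r (S) * σ (m - 1 - r) (Q) ≤ ‖Q S‖`. -/
theorem IsSingularSystem.mul_le_of_norm_comp_le (h : IsSingularSystem S e σ) {m : ℕ}
    {Q : F →ₗ[ℂ] G} {g : OrthonormalBasis (Fin m) ℂ F} {β : Fin m → ℝ}
    (hQ : IsSingularSystem Q g β) (hnm : n ≤ m) {θ : ℝ} (hθ : ∀ x, ‖Q (S x)‖ ≤ θ * ‖x‖)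
    (r : Fin n) : σ r * β (Fin.rev (Fin.castLE hnm r)) ≤ θ := by
  have hn : finrank ℂ E = n := by simpa using finrank_eq_card_basis e.toBasis
  obtain ⟨x, -, hx0, hx⟩ := exists_mem_ne_zero_of_card_lt_finrank (⊤ : Submodule ℂ E)
    (Sum.elim (fun j : Finset.Ioi r => innerₛₗ ℂ (e j))
      (fun j : Finset.Ioi (Fin.rev (Fin.castLE hnm r)) => innerₛₗ ℂ (g j) ∘ₗ S))
    (by
      simp only [Fintype.card_sum, Fintype.card_coe, Fin.card_Ioi, Fin.val_rev, Fin.val_castLE,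
        finrank_top, hn]
      omega)
  refine le_of_mul_le_mul_right ?_ (norm_pos_iff.2 hx0)
  have h1 : σ r * ‖x‖ ≤ ‖S x‖ :=
    h.mul_norm_le r fun j hj => hx (Sum.inl ⟨j, Finset.mem_Ioi.2 hj⟩)
  have h2 : β (Fin.rev (Fin.castLE hnm r)) * ‖S x‖ ≤ ‖Q (S x)‖ :=
    hQ.mul_norm_le _ fun j hj => hx (Sum.inr ⟨j, Finset.mem_Ioi.2 hj⟩)
  nlinarith [hθ x, mul_le_mul_of_nonneg_left h1 (hQ.nonneg (Fin.rev (Fin.castLE hnm r)))]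

theorem IsSingularSystem.prod_comp_eq {S : E →ₗ[ℂ] F} {e f g : OrthonormalBasis (Fin n) ℂ E}
    {σ τ c : Fin n → ℝ} (h : IsSingularSystem S e σ) {M : E →ₗ[ℂ] E}
    (h' : IsSingularSystem (S ∘ₗ M) g τ) (hM : ∀ i, M (f i) = (c i : ℂ) • f i)
    (hc : ∀ i, 0 ≤ c i) : ∏ i, τ i = (∏ i, σ i) * ∏ i, c i := by
  have hadj : LinearMap.adjoint M = M := by
    symm
    rw [LinearMap.eq_adjoint_iff_basis f.toBasis f.toBasis]
    intro i j
    simp only [f.coe_toBasis, hM, inner_smul_left, inner_smul_right, Complex.conj_ofReal,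
      orthonormal_iff_ite.1 f.orthonormal]
    split_ifs with hij
    · rw [hij]
    · simp
  have hdet : LinearMap.det M = ((∏ i, c i : ℝ) : ℂ) :=
    det_eq_prod_of_apply_basis f.toBasis fun i => by rw [f.coe_toBasis, hM]
  have h1 := h'.det_adjoint_comp_self
  have h2 : LinearMap.adjoint (S ∘ₗ M) ∘ₗ (S ∘ₗ M) =
      M ∘ₗ (LinearMap.adjoint S ∘ₗ S) ∘ₗ M := by
    rw [LinearMap.adjoint_comp, hadj]
    rfl
  rw [h2, LinearMap.det_comp, LinearMap.det_comp, h.det_adjoint_comp_self, hdet] at h1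
  norm_cast at h1
  rw [Finset.prod_pow, Finset.prod_pow] at h1
  refine (sq_eq_sq₀ (Finset.prod_nonneg fun i _ => h'.nonneg i) (mul_nonneg
    (Finset.prod_nonneg fun i _ => h.nonneg i) (Finset.prod_nonneg fun i _ => hc i))).1 ?_
  rw [← h1]
  ring

/-- A log-majorization inequality between the singular values of `S`, `Q` and `Q ∘ S`. -/
theorem IsSingularSystem.prod_max_mul_le (h : IsSingularSystem S e σ) {m : ℕ}
    {Q : F →ₗ[ℂ] G} {g : OrthonormalBasis (Fin m) ℂ F} {β : Fin m → ℝ}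
    (hQ : IsSingularSystem Q g β) {f : OrthonormalBasis (Fin n) ℂ E} {τ : Fin n → ℝ}
    (hQS : IsSingularSystem (Q ∘ₗ S) f τ) (hnm : n ≤ m) (hσ : ∀ t, 0 < σ t) {θ : ℝ}
    (hθ : 0 < θ) :
    ∏ t, max θ (σ t * β (Fin.rev (Fin.castLE hnm t))) ≤ ∏ t, max θ (τ t) := by
  have hn : finrank ℂ E = n := by simpa using finrank_eq_card_basis e.toBasis
  have hmax : ∀ a : ℝ, 0 < max θ a := fun a => lt_max_of_lt_left hθ
  let c : Fin n → ℝ := fun t => θ / max θ (τ t)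
  have hc0 : ∀ t, 0 < c t := fun t => div_pos hθ (hmax _)
  have hc1 : ∀ t, c t ≤ 1 := fun t => (div_le_one (hmax _)).2 (le_max_left _ _)
  have hcτ : ∀ t, τ t * c t ≤ θ := fun t => by
    rw [← mul_div_assoc, div_le_iff₀ (hmax _), mul_comm]
    exact mul_le_mul_of_nonneg_left (le_max_right _ _) hθ.le
  let M : E →ₗ[ℂ] E := f.toBasis.constr ℂ fun t => (c t : ℂ) • f t
  have hM : ∀ t, M (f t) = (c t : ℂ) • f t := fun t => by
    rw [← f.coe_toBasis, Basis.constr_basis, f.coe_toBasis]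
  have hMin : ∀ x t, inner ℂ (f t) (M x) = c t * inner ℂ (f t) x := fun x t => by
    conv_lhs => rw [← f.sum_repr x]
    simp only [map_sum, map_smul, hM, inner_sum, inner_smul_right,
      orthonormal_iff_ite.1 f.orthonormal]
    simp [f.repr_apply_apply, mul_comm]
  have hMx : ∀ x, ‖M x‖ ≤ ‖x‖ := fun x => by
    refine le_of_sq_le_sq ?_ (norm_nonneg _)
    rw [← f.sum_sq_norm_inner_right, ← f.sum_sq_norm_inner_right]
    refine Finset.sum_le_sum fun t _ => ?_
    rw [hMin, norm_mul, Complex.norm_real, Real.norm_of_nonneg (hc0 t).le]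
    gcongr
    exact mul_le_of_le_one_left (norm_nonneg _) (hc1 t)
  have hQM : ∀ x, ‖Q ((S ∘ₗ M) x)‖ ≤ θ * ‖x‖ := fun x => by
    refine le_of_sq_le_sq ?_ (by positivity)
    have := hQS.norm_sq_apply (M x)
    simp only [LinearMap.comp_apply] at this ⊢
    rw [this, mul_pow, ← f.sum_sq_norm_inner_right, Finset.mul_sum]
    refine Finset.sum_le_sum fun t _ => ?_
    rw [hMin, norm_mul, Complex.norm_real, Real.norm_of_nonneg (hc0 t).le, ← mul_pow, ← mul_assoc,
      mul_pow]
    have := mul_nonneg (hQS.nonneg t) (hc0 t).le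
    gcongr
    exact hcτ t
  obtain ⟨e', ρ, h'⟩ := exists_isSingularSystem (S ∘ₗ M) hn
  have hprod := h.prod_comp_eq h' hM fun t => (hc0 t).le
  have hle : ∀ t, ρ t * max θ (σ t * β (Fin.rev (Fin.castLE hnm t))) ≤ θ * σ t := fun t => by
    rw [mul_max_of_nonneg _ _ (h'.nonneg t)]
    refine max_le ?_ ?_
    · rw [mul_comm]
      exact mul_le_mul_of_nonneg_left (h.comp_contraction_le hMx h' t) hθ.le
    · rw [mul_left_comm, mul_comm]
      exact mul_le_mul_of_nonneg_right (h'.mul_le_of_norm_comp_le hQ hnm hQM t) (h.nonneg t)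
  have heq : ∏ t, ρ t * max θ (τ t) = ∏ t, θ * σ t := by
    rw [Finset.prod_mul_distrib, hprod, mul_assoc, ← Finset.prod_mul_distrib (f := c),
      mul_comm, ← Finset.prod_mul_distrib]
    exact Finset.prod_congr rfl fun t _ => by rw [div_mul_cancel₀ _ (hmax _).ne']
  have hρ : 0 < ∏ t, ρ t := by
    rw [hprod]
    exact mul_pos (Finset.prod_pos fun t _ => hσ t) (Finset.prod_pos fun t _ => hc0 t)
  refine le_of_mul_le_mul_left ?_ hρ
  rw [← Finset.prod_mul_distrib, ← Finset.prod_mul_distrib, heq]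
  exact Finset.prod_le_prod (fun t _ => mul_nonneg (h'.nonneg t) (hmax _).le) fun t _ => hle t

theorem exists_hyperplane_mem (e f : OrthonormalBasis (Fin (n + 1)) ℂ E) (s : Fin (n + 1)) :
    ∃ X : Submodule ℂ E, finrank ℂ X = n ∧ (∀ j < s, e j ∈ X) ∧ ∀ j, s < j → f j ∈ X := by
  have hn : finrank ℂ E = n + 1 := by simpa using finrank_eq_card_basis e.toBasis
  obtain ⟨v, -, hv0, hv⟩ := exists_mem_ne_zero_of_card_lt_finrank (⊤ : Submodule ℂ E)
    (Sum.elim (fun j : Finset.Iio s => innerₛₗ ℂ (e j)) (fun j : Finset.Ioi s => innerₛₗ ℂ (f j)))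
    (by
      simp only [Fintype.card_sum, Fintype.card_coe, Fin.card_Ioi, Fin.card_Iio, finrank_top, hn]
      omega)
  have : Fact (finrank ℂ E = n + 1) := ⟨hn⟩
  refine ⟨(ℂ ∙ v)ᗮ, Submodule.finrank_orthogonal_span_singleton hv0, fun j hj => ?_, fun j hj => ?_⟩
  · rw [Submodule.mem_orthogonal_singleton_iff_inner_left]
    exact hv (Sum.inl ⟨j, Finset.mem_Iio.2 hj⟩)
  · rw [Submodule.mem_orthogonal_singleton_iff_inner_left]
    exact hv (Sum.inr ⟨j, Finset.mem_Ioi.2 hj⟩)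

theorem IsSingularSystem.le_domRestrict {e : OrthonormalBasis (Fin (n + 1)) ℂ E}
    {σ : Fin (n + 1) → ℝ} (h : IsSingularSystem S e σ) {X : Submodule ℂ E}
    {e' : OrthonormalBasis (Fin n) ℂ X} {σ' : Fin n → ℝ}
    (h' : IsSingularSystem (S.domRestrict X) e' σ') {s : Fin (n + 1)}
    (hs : ∀ j < s, e j ∈ X) (r : Fin n) : σ (s.succAbove r) ≤ σ' r := by
  rcases lt_or_ge r.castSucc s with hr | hr
  · rw [Fin.succAbove_of_castSucc_lt _ _ hr]
    have hX : ∀ t : Finset.Iic r.castSucc, e t ∈ X := fun t =>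
      hs t ((Finset.mem_Iic.1 t.2).trans_lt hr)
    refine h'.le_of_finrank r _ ?_ fun x hx => h.mul_norm_le r.castSucc fun j hj =>
      inner_eq_zero_of_mem_span_range e hX (fun t ht => ?_) hx
    · rw [finrank_span_range_of_orthonormalBasis_mem e Subtype.val_injective, Fintype.card_coe,
        Fin.card_Iic]
      simp
    · exact (Finset.mem_Iic.1 t.2).not_gt (ht ▸ hj)
  · rw [Fin.succAbove_of_le_castSucc _ _ hr]
    have hn : finrank ℂ X = n := by simpa using finrank_eq_card_basis e'.toBasis
    obtain ⟨x, -, hx0, hx⟩ := exists_mem_ne_zero_of_card_lt_finrank (⊤ : Submodule ℂ X)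
      (Sum.elim (fun j : Finset.Ioi r.succ => innerₛₗ ℂ (e j) ∘ₗ X.subtype)
        (fun j : Finset.Iio r => innerₛₗ ℂ (e' j)))
      (by
        simp only [Fintype.card_sum, Fintype.card_coe, Fin.card_Ioi, Fin.card_Iio, Fin.val_succ,
          finrank_top, hn]
        omega)
    refine le_of_mul_le_mul_right ?_ (norm_pos_iff.2 hx0)
    exact (h.mul_norm_le r.succ fun j hj => hx (Sum.inl ⟨j, Finset.mem_Ioi.2 hj⟩)).trans
      (h'.norm_le_mul r fun j hj => hx (Sum.inr ⟨j, Finset.mem_Iio.2 hj⟩))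

theorem IsSingularSystem.domRestrict_le {e : OrthonormalBasis (Fin (n + 1)) ℂ E}
    {σ : Fin (n + 1) → ℝ} (h : IsSingularSystem S e σ) {X : Submodule ℂ E}
    {e' : OrthonormalBasis (Fin n) ℂ X} {σ' : Fin n → ℝ}
    (h' : IsSingularSystem (S.domRestrict X) e' σ') {s : Fin (n + 1)}
    (hs : ∀ j, s < j → e j ∈ X) (r : Fin n) : σ' r ≤ σ (s.succAbove r) := by
  rcases lt_or_ge r.castSucc s with hr | hr
  · rw [Fin.succAbove_of_castSucc_lt _ _ hr]
    have hn : finrank ℂ X = n := by simpa using finrank_eq_card_basis e'.toBasis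
    obtain ⟨x, -, hx0, hx⟩ := exists_mem_ne_zero_of_card_lt_finrank (⊤ : Submodule ℂ X)
      (Sum.elim (fun j : Finset.Iio r.castSucc => innerₛₗ ℂ (e j) ∘ₗ X.subtype)
        (fun j : Finset.Ioi r => innerₛₗ ℂ (e' j)))
      (by
        simp only [Fintype.card_sum, Fintype.card_coe, Fin.card_Ioi, Fin.card_Iio,
          Fin.val_castSucc, finrank_top, hn]
        omega)
    refine le_of_mul_le_mul_right ?_ (norm_pos_iff.2 hx0)
    exact (h'.mul_norm_le r fun j hj => hx (Sum.inr ⟨j, Finset.mem_Ioi.2 hj⟩)).trans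
      (h.norm_le_mul r.castSucc fun j hj => hx (Sum.inl ⟨j, Finset.mem_Iio.2 hj⟩))
  · rw [Fin.succAbove_of_le_castSucc _ _ hr]
    have hX : ∀ t : Finset.Ici r.succ, e t ∈ X := fun t =>
      hs t ((hr.trans_lt r.castSucc_lt_succ).trans_le (Finset.mem_Ici.1 t.2))
    refine h'.ge_of_finrank r _ ?_ fun x hx => h.norm_le_mul r.succ fun j hj =>
      inner_eq_zero_of_mem_span_range e hX (fun t ht => ?_) hx
    · rw [finrank_span_range_of_orthonormalBasis_mem e Subtype.val_injective, Fintype.card_coe,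
        Fin.card_Ici, Fin.val_succ]
      omega
    · exact (Finset.mem_Ici.1 t.2).not_gt (ht ▸ hj)

end SingularSystem

theorem IsSingularSystem.prod_max_mul_le_of_strictMono {F G : Type*}
    [NormedAddCommGroup F] [InnerProductSpace ℂ F] [FiniteDimensional ℂ F]
    [NormedAddCommGroup G] [InnerProductSpace ℂ G] [FiniteDimensional ℂ G] {m k : ℕ}
    {Q : F →ₗ[ℂ] G} {g : OrthonormalBasis (Fin m) ℂ F} {β : Fin m → ℝ}
    (hQ : IsSingularSystem Q g β) (hk : k ≤ m) {θ : ℝ} (hθ : 0 < θ) {n : ℕ} {E : Type*}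
    [NormedAddCommGroup E] [InnerProductSpace ℂ E] [FiniteDimensional ℂ E]
    {S : E →ₗ[ℂ] F} {e f : OrthonormalBasis (Fin n) ℂ E} {σ τ : Fin n → ℝ}
    (h : IsSingularSystem S e σ) (hQS : IsSingularSystem (Q ∘ₗ S) f τ) {i : Fin k → Fin n}
    (hi : StrictMono i) (hσ : ∀ t, 0 < σ (i t)) :
    ∏ t, max θ (σ (i t) * β (Fin.rev (Fin.castLE hk t))) ≤ ∏ t, max θ (τ (i t)) := by
  induction n generalizing E with
  | zero =>
    have : IsEmpty (Fin k) := ⟨fun t => (i t).elim0⟩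
    simp
  | succ n ih =>
    by_cases hs : Function.Surjective i
    · obtain rfl : k = n + 1 := by
        simpa using Fintype.card_of_bijective ⟨hi.injective, hs⟩
      obtain rfl : i = id := by
        have h1 := hi.range_inj strictMono_id
        simpa [hs.range_eq] using h1
      exact h.prod_max_mul_le hQ hQS hk hσ hθ
    · obtain ⟨s, hs⟩ : ∃ s, ∀ t, i t ≠ s := by simpa [Function.Surjective] using hs
      choose i' hi' using fun t => Fin.exists_succAbove_eq (hs t)
      obtain ⟨X, hX, hXe, hXf⟩ := exists_hyperplane_mem e f s
      obtain ⟨e', σ', h'⟩ := exists_isSingularSystem (S.domRestrict X) hX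
      obtain ⟨f', τ', hQS'⟩ := exists_isSingularSystem ((Q ∘ₗ S).domRestrict X) hX
      have hσσ : ∀ t, σ (i t) ≤ σ' (i' t) := fun t => hi' t ▸ h.le_domRestrict h' hXe (i' t)
      have hττ : ∀ t, τ' (i' t) ≤ τ (i t) := fun t => hi' t ▸ hQS.domRestrict_le hQS' hXf (i' t)
      have hmono : StrictMono i' := fun a b hab => by
        rw [← Fin.succAbove_lt_succAbove_iff (p := s), hi', hi']
        exact hi hab
      refine le_trans ?_ ((ih h' hQS' hmono fun t => (hσ t).trans_le (hσσ t)).trans ?_)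
      · refine Finset.prod_le_prod (fun t _ => le_max_of_le_left hθ.le) fun t _ => ?_
        exact max_le_max_left _ (mul_le_mul_of_nonneg_right (hσσ t) (hQ.nonneg _))
      · refine Finset.prod_le_prod (fun t _ => le_max_of_le_left hθ.le) fun t _ => ?_
        exact max_le_max_left _ (hττ t)

open scoped ComplexOrder in
theorem exists_isSingularSystem_singValDesc {n m : ℕ} (M : Matrix (Fin n) (Fin m) ℂ) :
    ∃ e, IsSingularSystem (Matrix.toEuclideanLin Mᴴ) e (singValDesc M) := by
  have hM := Matrix.isHermitian_mul_conjTranspose_self M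
  let ρ : Equiv.Perm (Fin n) := Fin.revPerm.trans (Tuple.sort hM.eigenvalues)
  refine ⟨hM.eigenvectorBasis.reindex ρ.symm, fun j => Real.sqrt_nonneg _, fun a b hab => ?_,
    fun j => ?_⟩
  · exact Real.sqrt_le_sqrt (Tuple.monotone_sort hM.eigenvalues (Fin.rev_le_rev.2 hab))
  · have hnn := (Matrix.posSemidef_self_mul_conjTranspose M).eigenvalues_nonneg (ρ j)
    have hsq : singValDesc M j ^ 2 = hM.eigenvalues (ρ j) := Real.sq_sqrt hnn
    rw [hsq, ← Matrix.toEuclideanLin_conjTranspose_eq_adjoint, Matrix.conjTranspose_conjTranspose,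
      OrthonormalBasis.reindex_apply, Equiv.symm_symm]
    have := hM.mulVec_eigenvectorBasis (ρ j)
    ext x
    simpa [Matrix.toLpLin_apply, Matrix.mulVec_mulVec] using congrFun this x

/-- Wang–Zhang: for indices `i 0 < i 1 < ⋯ < i (k-1)` (0-indexed, so the
1-indexed `i_t` of the informal statement is `i t + 1`) and `p > 0`,
`∑ₜ σ_{iₜ}(AB)^p ≥ ∑ₜ σ_{iₜ}(A)^p σ_{n-t+1}(B)^p`, where `σ_{n-t+1}(B)` (1-indexed)
is `singValDesc B (Fin.rev t)` (0-indexed). -/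
theorem singular_value_product {n m k : ℕ} (A : Matrix (Fin n) (Fin n) ℂ)
    (B : Matrix (Fin n) (Fin m) ℂ) (i : Fin k → Fin n) (hi : StrictMono i)
    (hk : k ≤ n) (p : ℝ) (hp : 0 < p) :
    ∑ t : Fin k, singValDesc A (i t) ^ p * singValDesc B (Fin.rev (Fin.castLE hk t)) ^ p ≤
      ∑ t : Fin k, singValDesc (A * B) (i t) ^ p := by
  obtain ⟨eA, hA⟩ := exists_isSingularSystem_singValDesc A
  obtain ⟨eB, hB⟩ := exists_isSingularSystem_singValDesc B
  obtain ⟨eC, hC⟩ := exists_isSingularSystem_singValDesc (A * B)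
  rw [Matrix.conjTranspose_mul, Matrix.toEuclideanLin, Matrix.toLpLin_mul (q := 2)] at hC
  induction k with
  | zero => simp
  | succ k ih =>
    rcases (hA.nonneg (i (Fin.last k))).eq_or_lt with h0 | hpos
    · rw [Fin.sum_univ_castSucc, Fin.sum_univ_castSucc, ← h0, Real.zero_rpow hp.ne', zero_mul]
      exact add_le_add (ih (fun t => i t.castSucc) (hi.comp Fin.strictMono_castSucc) (by omega))
        (Real.rpow_nonneg (hC.nonneg _) _)
    · simp only [← Real.mul_rpow (hA.nonneg _) (hB.nonneg _)]
      exact sum_rpow_le_sum_rpow_of_prod_max_le (fun t => mul_nonneg (hA.nonneg _) (hB.nonneg _))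
        (fun t => hC.nonneg _) (fun θ hθ => hB.prod_max_mul_le_of_strictMono hk hθ hA hC hi
          fun t => hpos.trans_le (hA.antitone (hi.monotone (Fin.le_last t)))) hp

end
end

section
/- Let z₁,…,z_m ∈ ℝⁿ, let Z be the associated rank-one sensing map with induced asymmetric map Z', let V ∈ ℝ^{n×n} be invertible, let Ẑ be the transformed sensing map Ẑ_i(Y) = (V⁻¹zᵢ)ᵀ Y (V⁻¹zᵢ), and let Ẑ' be its induced asymmetric map. Suppose that for some R ≥ 1 and constants C₁, C₂ > 0, every nonzero symmetric matrix X ∈ ℝ^{n×n} of rank at most R satisfies C₁ ≤ (‖Z'(X)‖₁/⌊m/2⌋)/‖X‖_F ≤ C₂. Then every nonzero symmetric matrix Y ∈ ℝ^{n×n} of rank at most R satisfies C₁/σ_max²(V) ≤ (‖Ẑ'(Y)‖₁/⌊m/2⌋)/‖Y‖_F ≤ C₂/σ_min²(V). -/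
open MeasureTheory Matrix

noncomputable section

/-- The quadratic form of a Hermitian matrix in an orthonormal eigenbasis. -/
lemma quadForm_eq_sum_eigenvalues {n : ℕ} {A : Matrix (Fin n) (Fin n) ℝ} (hA : A.IsHermitian)
    (w : Fin n → ℝ) :
    w ⬝ᵥ A *ᵥ w =
      ∑ i, hA.eigenvalues i * ((hA.eigenvectorBasis i).ofLp ⬝ᵥ w) ^ 2 := by
  have key := hA.eigenvectorBasis.sum_inner_mul_inner (WithLp.toLp 2 w) (WithLp.toLp 2 (A *ᵥ w))
  simp only [EuclideanSpace.inner_eq_star_dotProduct, star_trivial] at key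
  rw [dotProduct_comm, ← key]
  refine Finset.sum_congr rfl fun i _ => ?_
  have hi : A *ᵥ w ⬝ᵥ (hA.eigenvectorBasis i).ofLp =
      hA.eigenvalues i * ((hA.eigenvectorBasis i).ofLp ⬝ᵥ w) := by
    have hAt : Aᵀ = A := by simpa using hA.eq
    rw [dotProduct_comm, dotProduct_mulVec, ← mulVec_transpose, hAt,
      hA.mulVec_eigenvectorBasis, smul_dotProduct, smul_eq_mul]
  rw [hi]
  ring

/-- Parseval's identity in an orthonormal eigenbasis. -/
lemma dotProduct_self_eq_sum_eigenvectorBasis {n : ℕ} {A : Matrix (Fin n) (Fin n) ℝ}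
    (hA : A.IsHermitian) (w : Fin n → ℝ) :
    w ⬝ᵥ w = ∑ i, ((hA.eigenvectorBasis i).ofLp ⬝ᵥ w) ^ 2 := by
  have key := hA.eigenvectorBasis.sum_inner_mul_inner (WithLp.toLp 2 w) (WithLp.toLp 2 w)
  simp only [EuclideanSpace.inner_eq_star_dotProduct, star_trivial] at key
  rw [← key]
  refine Finset.sum_congr rfl fun i _ => ?_
  rw [dotProduct_comm w, sq]

lemma iInf_eigenvalues_mul_le_quadForm {n : ℕ} {A : Matrix (Fin n) (Fin n) ℝ}
    (hA : A.IsHermitian) (w : Fin n → ℝ) :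
    (⨅ i, hA.eigenvalues i) * (w ⬝ᵥ w) ≤ w ⬝ᵥ A *ᵥ w := by
  rw [quadForm_eq_sum_eigenvalues hA, dotProduct_self_eq_sum_eigenvectorBasis hA, Finset.mul_sum]
  exact Finset.sum_le_sum fun i _ =>
    mul_le_mul_of_nonneg_right (ciInf_le (Set.finite_range _).bddBelow i) (sq_nonneg _)

lemma quadForm_le_iSup_eigenvalues_mul {n : ℕ} {A : Matrix (Fin n) (Fin n) ℝ}
    (hA : A.IsHermitian) (w : Fin n → ℝ) :
    w ⬝ᵥ A *ᵥ w ≤ (⨆ i, hA.eigenvalues i) * (w ⬝ᵥ w) := by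
  rw [quadForm_eq_sum_eigenvalues hA, dotProduct_self_eq_sum_eigenvectorBasis hA, Finset.mul_sum]
  exact Finset.sum_le_sum fun i _ =>
    mul_le_mul_of_nonneg_right (le_ciSup (Set.finite_range _).bddAbove i) (sq_nonneg _)

lemma eigenvalues_mul_conjTranspose_self_nonneg {n : ℕ} (V : Matrix (Fin n) (Fin n) ℝ)
    (i : Fin n) : 0 ≤ (isHermitian_mul_conjTranspose_self V).eigenvalues i :=
  (posSemidef_self_mul_conjTranspose V).eigenvalues_nonneg i

lemma sigmaMin_sq {n : ℕ} (V : Matrix (Fin n) (Fin n) ℝ) :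
    sigmaMin V ^ 2 = ⨅ i, (isHermitian_mul_conjTranspose_self V).eigenvalues i :=
  Real.sq_sqrt (Real.iInf_nonneg (eigenvalues_mul_conjTranspose_self_nonneg V))

lemma sigmaMax_sq {n : ℕ} (V : Matrix (Fin n) (Fin n) ℝ) :
    sigmaMax V ^ 2 = ⨆ i, (isHermitian_mul_conjTranspose_self V).eigenvalues i :=
  Real.sq_sqrt (Real.iSup_nonneg (eigenvalues_mul_conjTranspose_self_nonneg V))

lemma sigmaMin_nonneg {n : ℕ} (V : Matrix (Fin n) (Fin n) ℝ) : 0 ≤ sigmaMin V :=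
  Real.sqrt_nonneg _

lemma sigmaMax_nonneg {n : ℕ} (V : Matrix (Fin n) (Fin n) ℝ) : 0 ≤ sigmaMax V :=
  Real.sqrt_nonneg _

lemma sigmaMin_pos {n : ℕ} [Nonempty (Fin n)] {V : Matrix (Fin n) (Fin n) ℝ}
    (hV : IsUnit V.det) : 0 < sigmaMin V := by
  obtain ⟨i, hi⟩ := exists_eq_ciInf_of_finite
    (f := (isHermitian_mul_conjTranspose_self V).eigenvalues)
  refine Real.sqrt_pos.2 (hi ▸ ?_)
  have hinj : Function.Injective V.vecMul :=
    vecMul_injective_iff_isUnit.2 ((isUnit_iff_isUnit_det V).2 hV)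
  exact (PosDef.mul_conjTranspose_self V hinj).eigenvalues_pos i

lemma frobNorm_nonneg {n : ℕ} (A : Matrix (Fin n) (Fin n) ℝ) : 0 ≤ frobNorm A :=
  Real.sqrt_nonneg _

lemma frobNorm_transpose {n : ℕ} (A : Matrix (Fin n) (Fin n) ℝ) : frobNorm Aᵀ = frobNorm A := by
  simp only [frobNorm, transpose_apply]
  rw [Finset.sum_comm]

lemma frobNorm_sq {n : ℕ} (A : Matrix (Fin n) (Fin n) ℝ) :
    frobNorm A ^ 2 = ∑ j, A.col j ⬝ᵥ A.col j := by
  rw [frobNorm, Real.sq_sqrt (by positivity), Finset.sum_comm]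
  simp only [dotProduct, col_apply, sq]

lemma frobNorm_pos {n : ℕ} {A : Matrix (Fin n) (Fin n) ℝ} (hA : A ≠ 0) : 0 < frobNorm A := by
  refine (frobNorm_nonneg A).lt_of_ne' fun h0 => hA ?_
  rw [frobNorm, Real.sqrt_eq_zero (by positivity)] at h0
  ext i j
  have hi := (Finset.sum_eq_zero_iff_of_nonneg fun i _ => by positivity).1 h0 i (Finset.mem_univ i)
  have hij := (Finset.sum_eq_zero_iff_of_nonneg fun j _ => by positivity).1 hi j (Finset.mem_univ j)
  simpa using hij

lemma frobNorm_transpose_mul_sq {n : ℕ} (V W : Matrix (Fin n) (Fin n) ℝ) :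
    frobNorm (Vᵀ * W) ^ 2 = ∑ j, W.col j ⬝ᵥ (V * Vᴴ) *ᵥ W.col j := by
  rw [frobNorm_sq]
  refine Finset.sum_congr rfl fun j _ => ?_
  have hcol : (Vᵀ * W).col j = Vᵀ *ᵥ W.col j := rfl
  rw [hcol, conjTranspose_eq_transpose_of_trivial, ← mulVec_mulVec,
    dotProduct_mulVec _ V, mulVec_transpose]

lemma sigmaMin_mul_frobNorm_le {n : ℕ} (V W : Matrix (Fin n) (Fin n) ℝ) :
    sigmaMin V * frobNorm W ≤ frobNorm (Vᵀ * W) := by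
  refine le_of_sq_le_sq ?_ (frobNorm_nonneg _)
  rw [mul_pow, frobNorm_transpose_mul_sq, frobNorm_sq, sigmaMin_sq, Finset.mul_sum]
  exact Finset.sum_le_sum fun j _ => iInf_eigenvalues_mul_le_quadForm _ _

lemma frobNorm_transpose_mul_le {n : ℕ} (V W : Matrix (Fin n) (Fin n) ℝ) :
    frobNorm (Vᵀ * W) ≤ sigmaMax V * frobNorm W := by
  refine le_of_sq_le_sq ?_ (mul_nonneg (sigmaMax_nonneg V) (frobNorm_nonneg W))
  rw [mul_pow, frobNorm_transpose_mul_sq, frobNorm_sq, sigmaMax_sq, Finset.mul_sum]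
  exact Finset.sum_le_sum fun j _ => quadForm_le_iSup_eigenvalues_mul _ _

lemma frobNorm_mul_eq_transpose_mul {n : ℕ} (X V : Matrix (Fin n) (Fin n) ℝ) :
    frobNorm (X * V) = frobNorm (Vᵀ * Xᵀ) := by
  rw [← transpose_mul, frobNorm_transpose]

lemma sigmaMin_sq_mul_frobNorm_le {n : ℕ} (V X : Matrix (Fin n) (Fin n) ℝ) :
    sigmaMin V ^ 2 * frobNorm X ≤ frobNorm (Vᵀ * (X * V)) :=
  calc sigmaMin V ^ 2 * frobNorm X = sigmaMin V * (sigmaMin V * frobNorm Xᵀ) := by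
        rw [frobNorm_transpose]; ring
    _ ≤ sigmaMin V * frobNorm (X * V) := by
        rw [frobNorm_mul_eq_transpose_mul]
        exact mul_le_mul_of_nonneg_left (sigmaMin_mul_frobNorm_le V Xᵀ) (sigmaMin_nonneg V)
    _ ≤ frobNorm (Vᵀ * (X * V)) := sigmaMin_mul_frobNorm_le V (X * V)

lemma frobNorm_congruence_le {n : ℕ} (V X : Matrix (Fin n) (Fin n) ℝ) :
    frobNorm (Vᵀ * (X * V)) ≤ sigmaMax V ^ 2 * frobNorm X :=
  calc frobNorm (Vᵀ * (X * V)) ≤ sigmaMax V * frobNorm (X * V) :=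
        frobNorm_transpose_mul_le V (X * V)
    _ ≤ sigmaMax V * (sigmaMax V * frobNorm Xᵀ) := by
        rw [frobNorm_mul_eq_transpose_mul]
        exact mul_le_mul_of_nonneg_left (frobNorm_transpose_mul_le V Xᵀ) (sigmaMax_nonneg V)
    _ = sigmaMax V ^ 2 * frobNorm X := by
        rw [frobNorm_transpose]; ring

lemma sensing_mulVec {n m : ℕ} (z : Fin m → Fin n → ℝ) (B Y : Matrix (Fin n) (Fin n) ℝ) :
    sensing (fun i => B *ᵥ z i) Y = sensing z (Bᵀ * Y * B) := by
  funext i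
  simp only [sensing]
  rw [← mulVec_mulVec, ← mulVec_mulVec, dotProduct_mulVec (z i), vecMul_transpose]

lemma sensingAsym_mulVec {n m : ℕ} (z : Fin m → Fin n → ℝ) (B Y : Matrix (Fin n) (Fin n) ℝ) :
    sensingAsym (fun i => B *ᵥ z i) Y = sensingAsym z (Bᵀ * Y * B) := by
  funext i
  simp only [sensingAsym, sensing_mulVec]

/-- the RUB property of the induced asymmetric map is inherited by the
transformed sensing map, with constants distorted by the extreme singular values of `V`. -/
theorem transformed_srub {n m : ℕ} (z : Fin m → Fin n → ℝ)
    (V : Matrix (Fin n) (Fin n) ℝ) (hV : IsUnit V.det)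
    (R : ℕ) (hR : 1 ≤ R) (C₁ C₂ : ℝ) (hC₁ : 0 < C₁) (hC₂ : 0 < C₂)
    (h : ∀ X : Matrix (Fin n) (Fin n) ℝ, X.IsHermitian → X ≠ 0 → X.rank ≤ R →
      C₁ ≤ l1Norm (sensingAsym z X) / ((m / 2 : ℕ) : ℝ) / frobNorm X ∧
      l1Norm (sensingAsym z X) / ((m / 2 : ℕ) : ℝ) / frobNorm X ≤ C₂) :
    ∀ Y : Matrix (Fin n) (Fin n) ℝ, Y.IsHermitian → Y ≠ 0 → Y.rank ≤ R →
      C₁ / sigmaMax V ^ 2 ≤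
        l1Norm (sensingAsym (fun i => V⁻¹.mulVec (z i)) Y) / ((m / 2 : ℕ) : ℝ) / frobNorm Y ∧
      l1Norm (sensingAsym (fun i => V⁻¹.mulVec (z i)) Y) / ((m / 2 : ℕ) : ℝ) / frobNorm Y ≤
        C₂ / sigmaMin V ^ 2 := by
  intro Y hY hY0 hYr
  rw [sensingAsym_mulVec]
  set X := V⁻¹ᵀ * Y * V⁻¹ with hX
  have hYX : Y = Vᵀ * (X * V) := by
    rw [hX, Matrix.mul_assoc _ V⁻¹ V, nonsing_inv_mul V hV, Matrix.mul_one, ← Matrix.mul_assoc,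
      ← transpose_mul, nonsing_inv_mul V hV, transpose_one, Matrix.one_mul]
  have hX0 : X ≠ 0 := fun h0 => hY0 (by rw [hYX, h0, Matrix.zero_mul, Matrix.mul_zero])
  have hXH : X.IsHermitian := by
    simpa [hX] using isHermitian_conjTranspose_mul_mul V⁻¹ hY
  have hXr : X.rank ≤ R :=
    (rank_mul_le_left _ _).trans ((rank_mul_le_right _ _).trans hYr)
  obtain ⟨hlow, hup⟩ := h X hXH hX0 hXr
  have : Nonempty (Fin n) := by
    by_contra hn
    rw [not_nonempty_iff] at hn
    exact hY0 (Subsingleton.elim _ _)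
  have hXpos := frobNorm_pos hX0
  have hYpos := frobNorm_pos hY0
  have hmin : 0 < sigmaMin V ^ 2 := pow_pos (sigmaMin_pos hV) 2
  have hYmin : sigmaMin V ^ 2 * frobNorm X ≤ frobNorm Y :=
    hYX ▸ sigmaMin_sq_mul_frobNorm_le V X
  have hYmax : frobNorm Y ≤ sigmaMax V ^ 2 * frobNorm X :=
    hYX ▸ frobNorm_congruence_le V X
  have hmax : 0 < sigmaMax V ^ 2 := pos_of_mul_pos_left (hYpos.trans_le hYmax) hXpos.le
  rw [le_div_iff₀ hXpos] at hlow
  rw [div_le_iff₀ hXpos] at hup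
  constructor
  · rw [div_le_div_iff₀ hmax hYpos]
    nlinarith [mul_le_mul_of_nonneg_left hYmax hC₁.le, mul_le_mul_of_nonneg_right hlow hmax.le]
  · rw [div_le_div_iff₀ hYpos hmin]
    nlinarith [mul_le_mul_of_nonneg_left hYmin hC₂.le, mul_le_mul_of_nonneg_right hup hmin.le]

end
end

section
/- Fix parameters k ≥ 2, 0 < C₁ < 1/3, and C₂ > 1. Then there exist positive constants C and δ (depending on k, C₁, C₂) such that for all n, r ≥ 1 and m > C·n·r, if z₁,…,z_m are drawn i.i.d. from the standard multivariate normal distribution N(0, I_n) on ℝⁿ, then with probability at least 1 − exp(−m·δ) the associated rank-one sensing map Z satisfies the SRUB property of order 2kr with constants C₁, C₂. -/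
open MeasureTheory Matrix

noncomputable section

section SRUB

open ProbabilityTheory

theorem card_le_of_separated_closedBall {E : Type*} [NormedAddCommGroup E] [NormedSpace ℝ E]
    [FiniteDimensional ℝ E] {ε : ℝ} (hε : 0 < ε) (s : Finset E) (hs : ∀ c ∈ s, ‖c‖ ≤ 1)
    (h : ∀ c ∈ s, ∀ d ∈ s, c ≠ d → ε ≤ ‖c - d‖) :
    (s.card : ℝ) ≤ (1 + 2 / ε) ^ Module.finrank ℝ E := by
  borelize E
  let μ : Measure E := Measure.addHaar
  have hδ : 0 < ε / 2 := by positivity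
  have hρ : 0 < 1 + ε / 2 := by positivity
  have D : Set.Pairwise (s : Set E) (Function.onFun Disjoint fun c => Metric.ball (c : E) (ε / 2)) := by
    rintro c hc d hd hcd
    apply Metric.ball_disjoint_ball
    rw [dist_eq_norm]
    linarith [h c hc d hd hcd]
  have hsub : (⋃ c ∈ s, Metric.ball (c : E) (ε / 2)) ⊆ Metric.ball (0 : E) (1 + ε / 2) := by
    refine Set.iUnion₂_subset fun x hx => Metric.ball_subset_ball' ?_
    rw [dist_zero_right]
    linarith [hs x hx]
  have I : (s.card : ENNReal) * ENNReal.ofReal ((ε / 2) ^ Module.finrank ℝ E) * μ (Metric.ball 0 1) ≤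
      ENNReal.ofReal ((1 + ε / 2) ^ Module.finrank ℝ E) * μ (Metric.ball 0 1) := by
    rw [← μ.addHaar_ball_of_pos (0 : E) hρ]
    refine le_trans (le_of_eq ?_) (measure_mono hsub)
    rw [measure_biUnion_finset D fun c _ => measurableSet_ball]
    simp only [μ.addHaar_ball_of_pos _ hδ, Finset.sum_const, nsmul_eq_mul, mul_assoc]
  have J := (ENNReal.mul_le_mul_iff_left (Metric.measure_ball_pos μ _ zero_lt_one).ne'
    measure_ball_lt_top.ne).1 I
  have K := ENNReal.toReal_le_of_le_ofReal (pow_nonneg hρ.le _) J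
  rw [ENNReal.toReal_mul, ENNReal.toReal_natCast, ENNReal.toReal_ofReal (by positivity)] at K
  rw [← le_div_iff₀ (by positivity), ← div_pow] at K
  convert! K using 2
  field_simp
  ring

/-- In a finite-dimensional normed space the closed unit ball has an `ε`-net of cardinality at
most `(1 + 2 / ε) ^ d`. -/
theorem exists_finset_net_closedBall (E : Type*) [NormedAddCommGroup E] [NormedSpace ℝ E]
    [FiniteDimensional ℝ E] {ε : ℝ} (hε : 0 < ε) :
    ∃ s : Finset E, (s.card : ℝ) ≤ (1 + 2 / ε) ^ Module.finrank ℝ E ∧ (∀ c ∈ s, ‖c‖ ≤ 1) ∧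
      ∀ x : E, ‖x‖ ≤ 1 → ∃ c ∈ s, ‖x - c‖ ≤ ε := by
  classical
  let good (s : Finset E) : Prop :=
    (∀ c ∈ s, ‖c‖ ≤ 1) ∧ ∀ c ∈ s, ∀ d ∈ s, c ≠ d → ε ≤ ‖c - d‖
  let cards : Set ℕ := {k | ∃ s : Finset E, good s ∧ s.card = k}
  have hbdd : BddAbove cards := by
    refine ⟨⌊(1 + 2 / ε) ^ Module.finrank ℝ E⌋₊, ?_⟩
    rintro _ ⟨s, hs, rfl⟩
    exact Nat.le_floor (card_le_of_separated_closedBall hε s hs.1 hs.2)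
  have hne : cards.Nonempty := ⟨0, ∅, by simp [good], rfl⟩
  obtain ⟨s, hs, hcard⟩ := Nat.sSup_mem hne hbdd
  refine ⟨s, card_le_of_separated_closedBall hε s hs.1 hs.2, hs.1, fun x hx => ?_⟩
  by_contra! hfar
  have hxs : x ∉ s := fun hxs => by
    have := hfar x hxs
    simp at this
    linarith
  have hgood : good (insert x s) := by
    refine ⟨by simpa [hx] using hs.1, ?_⟩
    intro c hc d hd hcd
    rw [Finset.mem_insert] at hc hd
    rcases hc with rfl | hc <;> rcases hd with rfl | hd
    · exact absurd rfl hcd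
    · exact (hfar d hd).le
    · rw [norm_sub_rev]; exact (hfar c hc).le
    · exact hs.2 c hc d hd hcd
  have := le_csSup hbdd ⟨insert x s, hgood, rfl⟩
  rw [Finset.card_insert_of_notMem hxs] at this
  omega

theorem sq_le_mul_exp_quarter {x : ℝ} (hx : 0 ≤ x) : x ^ 2 ≤ 32 * Real.exp (x / 4) := by
  have := Real.quadratic_le_exp_of_nonneg (x := x / 4) (by positivity)
  nlinarith

theorem exp_le_one_add_add_sq_mul_exp {y : ℝ} (hy : 0 ≤ y) :
    Real.exp y ≤ 1 + y + y ^ 2 * Real.exp y := by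
  have h1 : Real.exp y * (1 - y) ≤ 1 := by
    have := Real.add_one_le_exp (-y)
    have h2 := mul_le_mul_of_nonneg_left this (Real.exp_pos y).le
    rw [← Real.exp_add] at h2
    simp at h2
    linarith
  have h2 : 1 + y ≤ Real.exp y := by linarith [Real.add_one_le_exp y]
  by_cases h : y ≤ 1
  · nlinarith [Real.exp_pos y]
  · push Not at h
    nlinarith [Real.exp_pos y, mul_pos (Real.exp_pos y) (by nlinarith : 0 < y ^ 2 - 1)]

theorem exp_neg_le_quadratic {y : ℝ} (hy : 0 ≤ y) : Real.exp (-y) ≤ 1 - y + y ^ 2 / 2 := by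
  have h := Real.quadratic_le_exp_of_nonneg hy
  rw [Real.exp_neg, inv_le_comm₀ (Real.exp_pos y) (by nlinarith [sq_nonneg (y - 1)])]
  refine le_trans ?_ h
  rw [inv_le_iff_one_le_mul₀ (by nlinarith [sq_nonneg (y - 1)])]
  nlinarith [sq_nonneg (y ^ 2)]

section Concentration

variable {Ω : Type*} [MeasurableSpace Ω] {ρ : Measure Ω} {f : Ω → ℝ}

theorem integrable_of_integrable_exp_half (hf : Measurable f) (hf0 : ∀ ω, 0 ≤ f ω)
    (hint : Integrable (fun ω => Real.exp (f ω / 2)) ρ) : Integrable f ρ := by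
  refine (hint.const_mul 2).mono' hf.aestronglyMeasurable (ae_of_all _ fun ω => ?_)
  rw [Real.norm_of_nonneg (hf0 ω)]
  linarith [Real.add_one_le_exp (f ω / 2)]

theorem integrable_exp_mul_of_integrable_exp_half (hf : Measurable f) (hf0 : ∀ ω, 0 ≤ f ω)
    (hint : Integrable (fun ω => Real.exp (f ω / 2)) ρ) {s : ℝ} (hs : s ≤ 1 / 4) :
    Integrable (fun ω => Real.exp (s * f ω)) ρ := by
  refine hint.mono' (by fun_prop) (ae_of_all _ fun ω => ?_)
  rw [Real.norm_of_nonneg (Real.exp_pos _).le, Real.exp_le_exp]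
  nlinarith [hf0 ω]

variable [IsProbabilityMeasure ρ]

theorem mgf_le_of_integral_exp_half_le (hf : Measurable f) (hf0 : ∀ ω, 0 ≤ f ω)
    (hint : Integrable (fun ω => Real.exp (f ω / 2)) ρ)
    (hexp : ∫ ω, Real.exp (f ω / 2) ∂ρ ≤ 4) {s : ℝ} (hs0 : 0 ≤ s) (hs : s ≤ 1 / 4) :
    mgf f ρ s ≤ Real.exp (s * ∫ ω, f ω ∂ρ + 128 * s ^ 2) := by
  have hfi := integrable_of_integrable_exp_half hf hf0 hint
  have hpt : ∀ ω, Real.exp (s * f ω) ≤ 1 + s * f ω + 32 * s ^ 2 * Real.exp (f ω / 2) := by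
    intro ω
    have h1 := exp_le_one_add_add_sq_mul_exp (mul_nonneg hs0 (hf0 ω))
    have h2 : Real.exp (s * f ω) ≤ Real.exp (f ω / 4) :=
      Real.exp_le_exp.2 (by nlinarith [hf0 ω])
    have h3 := sq_le_mul_exp_quarter (hf0 ω)
    have h4 : Real.exp (f ω / 2) = Real.exp (f ω / 4) * Real.exp (f ω / 4) := by
      rw [← Real.exp_add]; ring_nf
    have h5 : f ω ^ 2 * Real.exp (s * f ω) ≤ 32 * Real.exp (f ω / 2) := by
      rw [h4, ← mul_assoc]
      exact mul_le_mul h3 h2 (Real.exp_pos _).le (by positivity)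
    nlinarith [mul_le_mul_of_nonneg_left h5 (sq_nonneg s)]
  calc mgf f ρ s ≤ ∫ ω, (1 + s * f ω + 32 * s ^ 2 * Real.exp (f ω / 2)) ∂ρ :=
        integral_mono (integrable_exp_mul_of_integrable_exp_half hf hf0 hint hs)
          (((integrable_const _).add (hfi.const_mul s)).add (hint.const_mul _)) hpt
    _ = 1 + s * ∫ ω, f ω ∂ρ + 32 * s ^ 2 * ∫ ω, Real.exp (f ω / 2) ∂ρ := by
        have hi : Integrable (fun ω => 1 + s * f ω) ρ :=
          (integrable_const _).add (hfi.const_mul s)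
        rw [integral_add hi (hint.const_mul _), integral_add (integrable_const _) (hfi.const_mul s),
          integral_const_mul, integral_const_mul]
        simp
    _ ≤ s * ∫ ω, f ω ∂ρ + 128 * s ^ 2 + 1 := by nlinarith [sq_nonneg s]
    _ ≤ _ := Real.add_one_le_exp _

theorem mgf_neg_le_of_integral_sq_le (hf : Measurable f) (hf0 : ∀ ω, 0 ≤ f ω)
    (hint : Integrable (fun ω => Real.exp (f ω / 2)) ρ) (hsqi : Integrable (fun ω => f ω ^ 2) ρ)
    (hsq : ∫ ω, f ω ^ 2 ∂ρ ≤ 1) {s : ℝ} (hs0 : 0 ≤ s) :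
    mgf f ρ (-s) ≤ Real.exp (-(s * ∫ ω, f ω ∂ρ) + 128 * s ^ 2) := by
  have hfi := integrable_of_integrable_exp_half hf hf0 hint
  have hpt : ∀ ω, Real.exp (-s * f ω) ≤ 1 - s * f ω + s ^ 2 / 2 * f ω ^ 2 := by
    intro ω
    have h1 := exp_neg_le_quadratic (mul_nonneg hs0 (hf0 ω))
    rw [neg_mul]
    linarith [mul_pow s (f ω) 2]
  calc mgf f ρ (-s) ≤ ∫ ω, (1 - s * f ω + s ^ 2 / 2 * f ω ^ 2) ∂ρ :=
        integral_mono
          (integrable_exp_mul_of_integrable_exp_half hf hf0 hint (by linarith))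
          (((integrable_const _).sub (hfi.const_mul s)).add (hsqi.const_mul _)) hpt
    _ = 1 - s * ∫ ω, f ω ∂ρ + s ^ 2 / 2 * ∫ ω, f ω ^ 2 ∂ρ := by
        have hi : Integrable (fun ω => 1 - s * f ω) ρ :=
          (integrable_const _).sub (hfi.const_mul s)
        rw [integral_add hi (hsqi.const_mul _), integral_sub (integrable_const _) (hfi.const_mul s),
          integral_const_mul, integral_const_mul]
        simp
    _ ≤ -(s * ∫ ω, f ω ∂ρ) + 128 * s ^ 2 + 1 := by nlinarith [sq_nonneg s]
    _ ≤ _ := Real.add_one_le_exp _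

/-- The mean of `M` independent copies of a nonnegative sub-exponential variable deviates from its
expectation by `t` with exponentially small probability. -/
theorem measureReal_pi_deviation_le (hf : Measurable f) (hf0 : ∀ ω, 0 ≤ f ω)
    (hint : Integrable (fun ω => Real.exp (f ω / 2)) ρ)
    (hexp : ∫ ω, Real.exp (f ω / 2) ∂ρ ≤ 4) (hsqi : Integrable (fun ω => f ω ^ 2) ρ)
    (hsq : ∫ ω, f ω ^ 2 ∂ρ ≤ 1) {M : ℕ} (hM : 0 < M) {s t : ℝ}
    (hs0 : 0 ≤ s) (hs : s ≤ 1 / 4) (hst : 256 * s ≤ t) :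
    (Measure.pi fun _ : Fin M => ρ).real
        {w | t < |(M : ℝ)⁻¹ * ∑ i, f (w i) - ∫ ω, f ω ∂ρ|} ≤
      2 * Real.exp (-(M * (s * t / 2))) := by
  set μ := ∫ ω, f ω ∂ρ
  set Q := Measure.pi fun _ : Fin M => ρ
  let F : Fin M → (Fin M → Ω) → ℝ := fun i w => f (w i)
  have hind : iIndepFun F Q := iIndepFun_pi (X := fun _ => f) fun _ => hf.aemeasurable
  have hFm : ∀ i, Measurable (F i) := fun i => hf.comp (measurable_pi_apply i)
  have hmgf1 : ∀ i a, mgf (F i) Q a = mgf f ρ a := fun i a =>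
    integral_comp_eval (μ := fun _ : Fin M => ρ) (i := i) (f := fun ω => Real.exp (a * f ω))
      (by fun_prop)
  have hmgf : ∀ a, mgf (∑ i, F i) Q a = mgf f ρ a ^ M := by
    intro a
    rw [hind.mgf_sum hFm]
    simp [hmgf1]
  have hinteg : ∀ a ≤ (1 / 4 : ℝ), Integrable (fun w => Real.exp (a * (∑ i, F i) w)) Q := by
    intro a ha
    refine hind.integrable_exp_mul_sum hFm fun i _ => ?_
    exact integrable_comp_eval (μ := fun _ : Fin M => ρ) (i := i) (f := fun ω => Real.exp (a * f ω))
      (integrable_exp_mul_of_integrable_exp_half hf hf0 hint ha)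
  have hup := measure_ge_le_exp_mul_mgf (μ := Q) (X := ∑ i, F i) (M * (μ + t)) hs0 (hinteg s hs)
  have hlo := measure_le_le_exp_mul_mgf (μ := Q) (X := ∑ i, F i) (M * (μ - t))
    (neg_nonpos.2 hs0) (hinteg (-s) (by linarith))
  have hM' : (0 : ℝ) < M := by exact_mod_cast hM
  have hkey : M * (128 * s ^ 2 - s * t) ≤ -(M * (s * t / 2)) := by
    have : 256 * s * s ≤ t * s := mul_le_mul_of_nonneg_right hst hs0
    nlinarith
  have hup' : Q.real {w | M * (μ + t) ≤ (∑ i, F i) w} ≤ Real.exp (-(M * (s * t / 2))) := by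
    refine hup.trans ?_
    rw [hmgf]
    calc Real.exp (-s * (M * (μ + t))) * mgf f ρ s ^ M
        ≤ Real.exp (-s * (M * (μ + t))) * Real.exp (s * μ + 128 * s ^ 2) ^ M := by
          gcongr
          · exact mgf_nonneg
          · exact mgf_le_of_integral_exp_half_le hf hf0 hint hexp hs0 hs
      _ = Real.exp (M * (128 * s ^ 2 - s * t)) := by
          rw [← Real.exp_nat_mul, ← Real.exp_add]; ring_nf
      _ ≤ _ := Real.exp_le_exp.2 hkey
  have hlo' : Q.real {w | (∑ i, F i) w ≤ M * (μ - t)} ≤ Real.exp (-(M * (s * t / 2))) := by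
    refine hlo.trans ?_
    rw [hmgf]
    calc Real.exp (- -s * (M * (μ - t))) * mgf f ρ (-s) ^ M
        ≤ Real.exp (- -s * (M * (μ - t))) * Real.exp (-(s * μ) + 128 * s ^ 2) ^ M := by
          gcongr
          · exact mgf_nonneg
          · exact mgf_neg_le_of_integral_sq_le hf hf0 hint hsqi hsq hs0
      _ = Real.exp (M * (128 * s ^ 2 - s * t)) := by
          rw [← Real.exp_nat_mul, ← Real.exp_add]; ring_nf
      _ ≤ _ := Real.exp_le_exp.2 hkey
  calc Q.real {w | t < |(M : ℝ)⁻¹ * ∑ i, f (w i) - μ|}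
      ≤ Q.real ({w | M * (μ + t) ≤ (∑ i, F i) w} ∪ {w | (∑ i, F i) w ≤ M * (μ - t)}) := by
        refine measureReal_mono fun w hw => ?_
        simp only [Set.mem_union, Set.mem_ofPred_eq, Finset.sum_apply, F] at hw ⊢
        have hS : ∑ i, f (w i) = M * ((M : ℝ)⁻¹ * ∑ i, f (w i)) := by field_simp
        rw [hS]
        rcases lt_abs.1 hw with h | h
        · left; gcongr; linarith
        · right; gcongr; linarith
    _ ≤ _ := measureReal_union_le _ _
    _ ≤ _ := by linarith

end Concentration

theorem integral_pow_two_gaussianReal : ∫ x, x ^ 2 ∂(gaussianReal 0 1) = 1 := by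
  have := variance_of_integral_eq_zero (μ := gaussianReal 0 1) (X := id) (by fun_prop) (by simp)
  simpa using this.symm

theorem integral_pow_four_gaussianReal : ∫ x, x ^ 4 ∂(gaussianReal 0 1) = 3 := by
  have h := iteratedDeriv_mgf_zero (μ := gaussianReal 0 1) (X := id) (by simp) 4
  have hm : mgf id (gaussianReal 0 1) = fun t => Real.exp (t ^ 2 / 2) := by
    rw [mgf_id_gaussianReal]; simp
  have key : ∀ (p q : ℝ → ℝ), (∀ t, HasDerivAt p (q t) t) →
      deriv (fun t => p t * Real.exp (t ^ 2 / 2)) =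
        fun t => (q t + t * p t) * Real.exp (t ^ 2 / 2) := by
    intro p q hp
    ext t
    have he : HasDerivAt (fun t : ℝ => Real.exp (t ^ 2 / 2)) (Real.exp (t ^ 2 / 2) * t) t := by
      convert! (((hasDerivAt_id t).pow 2).div_const 2).exp using 1
      simp
    refine ((hp t).mul he).deriv.trans ?_
    ring
  have h1 : deriv (fun t => Real.exp (t ^ 2 / 2)) = fun t => t * Real.exp (t ^ 2 / 2) := by
    have := key (fun _ => 1) (fun _ => 0) (fun t => hasDerivAt_const t 1)
    simpa using this
  have h2 := key (fun t => t) (fun _ => 1) hasDerivAt_id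
  have h3 := key (fun t => 1 + t * t) (fun t => 2 * t) (fun t => by
    convert! ((hasDerivAt_id t).mul (hasDerivAt_id t)).const_add 1 using 1; simp; ring)
  have h4 := key (fun t => 2 * t + t * (1 + t * t)) (fun t => 3 + 3 * (t * t)) (fun t => by
    convert! ((hasDerivAt_id t).const_mul 2).add ((hasDerivAt_id t).mul
      (((hasDerivAt_id t).mul (hasDerivAt_id t)).const_add 1)) using 1; simp; ring)
  rw [hm] at h
  simp only [iteratedDeriv_succ, iteratedDeriv_zero, h1, h2, h3, h4] at h
  simpa using h.symm

theorem integrable_exp_sq_gaussianReal :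
    Integrable (fun x => Real.exp (x ^ 2 / 8)) (gaussianReal 0 1) ∧
      ∫ x, Real.exp (x ^ 2 / 8) ∂(gaussianReal 0 1) ≤ 2 := by
  have hpdf : ∀ x : ℝ, gaussianPDFReal 0 1 x * Real.exp (x ^ 2 / 8) =
      (√(2 * Real.pi))⁻¹ * Real.exp (-(3 / 8) * x ^ 2) := by
    intro x
    rw [gaussianPDFReal_def]
    simp only [NNReal.coe_one, mul_one, sub_zero]
    rw [mul_assoc, ← Real.exp_add]
    ring_nf
  constructor
  · rw [gaussianReal_of_var_ne_zero _ one_ne_zero]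
    rw [integrable_withDensity_iff_integrable_smul' (measurable_gaussianPDF _ _)
      (ae_of_all _ fun x => gaussianPDF_lt_top)]
    simp only [toReal_gaussianPDF, smul_eq_mul, hpdf]
    exact (integrable_exp_neg_mul_sq (by norm_num)).const_mul _
  · rw [integral_gaussianReal_eq_integral_smul one_ne_zero]
    simp only [smul_eq_mul, hpdf]
    rw [integral_const_mul, integral_gaussian, inv_mul_le_iff₀ (by positivity)]
    refine Real.sqrt_le_iff.2 ⟨by positivity, ?_⟩
    rw [mul_pow, Real.sq_sqrt (by positivity)]
    have := Real.pi_pos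
    rw [div_le_iff₀ (by norm_num)]
    linarith

section Pi

variable {n : ℕ}

/-- The standard Gaussian measure on `Fin n → ℝ`. -/
abbrev gaussianPi (n : ℕ) : Measure (Fin n → ℝ) := Measure.pi fun _ => gaussianReal 0 1

theorem isGaussian_gaussianPi (n : ℕ) : IsGaussian (gaussianPi n) := by
  have h : HasGaussianLaw (fun u : Fin n → ℝ => fun i => u i) (gaussianPi n) :=
    iIndepFun.hasGaussianLaw
      (fun i => ⟨by rw [(measurePreserving_eval _ i).map_eq]; infer_instance⟩)
      (iIndepFun_pi (X := fun _ => id) fun _ => aemeasurable_id)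
  simpa using h.isGaussian_map

theorem map_dotProduct_gaussianPi (a : Fin n → ℝ) :
    (gaussianPi n).map (fun u => a ⬝ᵥ u) =
      (gaussianReal 0 1).map (fun x => √(a ⬝ᵥ a) * x) := by
  apply Measure.ext_of_charFun
  ext t
  rw [gaussianReal_map_const_mul, charFun_gaussianReal, charFun_apply_real,
    integral_map (by fun_prop) (by fun_prop)]
  have : ∀ u : Fin n → ℝ, Complex.exp (t * ((a ⬝ᵥ u : ℝ) : ℂ) * Complex.I) =
      ∏ i, Complex.exp (((t * a i : ℝ) : ℂ) * (u i : ℂ) * Complex.I) := by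
    intro u
    rw [← Complex.exp_sum, dotProduct]
    push_cast
    rw [Finset.mul_sum, Finset.sum_mul]
    congr 1
    exact Finset.sum_congr rfl fun i _ => by ring
  simp_rw [this]
  rw [integral_fintype_prod_eq_prod
    (f := fun i (x : ℝ) => Complex.exp (((t * a i : ℝ) : ℂ) * (x : ℂ) * Complex.I))]
  simp_rw [← charFun_apply_real, charFun_gaussianReal]
  rw [← Complex.exp_sum]
  congr 1
  have hs : ((√(a ⬝ᵥ a) : ℝ) : ℂ) ^ 2 = ∑ i, (a i : ℂ) ^ 2 := by
    rw [← Complex.ofReal_pow, Real.sq_sqrt (by rw [dotProduct]; exact Finset.sum_nonneg fun i _ => mul_self_nonneg _)]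
    simp [dotProduct, sq]
  simp [hs, ← Finset.sum_div, ← Finset.mul_sum, mul_pow, mul_comm]

end Pi

section Pi

variable {n : ℕ}

theorem dotProduct_self_nonneg_real (a : Fin n → ℝ) : 0 ≤ a ⬝ᵥ a :=
  Finset.sum_nonneg fun i _ => mul_self_nonneg (a i)

theorem integral_comp_dotProduct_gaussianPi (a : Fin n → ℝ) {h : ℝ → ℝ} (hh : Measurable h) :
    ∫ u, h (a ⬝ᵥ u) ∂(gaussianPi n) = ∫ x, h (√(a ⬝ᵥ a) * x) ∂(gaussianReal 0 1) := by
  rw [← integral_map (φ := fun u => a ⬝ᵥ u) (by fun_prop) hh.aestronglyMeasurable,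
    map_dotProduct_gaussianPi, integral_map (by fun_prop) hh.aestronglyMeasurable]

theorem integrable_comp_dotProduct_gaussianPi (a : Fin n → ℝ) {h : ℝ → ℝ} (hh : Measurable h)
    (hi : Integrable (fun x => h (√(a ⬝ᵥ a) * x)) (gaussianReal 0 1)) :
    Integrable (fun u => h (a ⬝ᵥ u)) (gaussianPi n) := by
  have h1 : Integrable h ((gaussianPi n).map (fun u => a ⬝ᵥ u)) := by
    rw [map_dotProduct_gaussianPi]
    exact (integrable_map_measure hh.aestronglyMeasurable (by fun_prop)).2 hi
  exact (integrable_map_measure hh.aestronglyMeasurable (by fun_prop)).1 h1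

theorem integrable_pow_gaussianReal (k : ℕ) : Integrable (fun x => x ^ k) (gaussianReal 0 1) := by
  have := (memLp_id_gaussianReal (μ := 0) (v := 1) k).integrable_norm_pow'
  refine this.mono' (by fun_prop) (ae_of_all _ fun x => ?_)
  simp

theorem integrable_dotProduct_pow (a : Fin n → ℝ) (k : ℕ) :
    Integrable (fun u => (a ⬝ᵥ u) ^ k) (gaussianPi n) := by
  refine integrable_comp_dotProduct_gaussianPi a (h := fun x => x ^ k) (by fun_prop) ?_
  simp_rw [mul_pow]
  exact (integrable_pow_gaussianReal k).const_mul _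

theorem integral_dotProduct_sq (a : Fin n → ℝ) :
    ∫ u, (a ⬝ᵥ u) ^ 2 ∂(gaussianPi n) = a ⬝ᵥ a := by
  rw [integral_comp_dotProduct_gaussianPi a (h := fun x => x ^ 2) (by fun_prop)]
  simp_rw [mul_pow]
  rw [integral_const_mul, integral_pow_two_gaussianReal,
    Real.sq_sqrt (dotProduct_self_nonneg_real a), mul_one]

theorem integral_dotProduct_pow_four (a : Fin n → ℝ) :
    ∫ u, (a ⬝ᵥ u) ^ 4 ∂(gaussianPi n) = 3 * (a ⬝ᵥ a) ^ 2 := by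
  rw [integral_comp_dotProduct_gaussianPi a (h := fun x => x ^ 4) (by fun_prop)]
  simp_rw [mul_pow]
  rw [integral_const_mul, integral_pow_four_gaussianReal, show 4 = 2 * 2 from rfl, pow_mul,
    Real.sq_sqrt (dotProduct_self_nonneg_real a), mul_comm]

theorem integrable_exp_dotProduct (a : Fin n → ℝ) (c : ℝ) :
    Integrable (fun u => Real.exp (c * (a ⬝ᵥ u))) (gaussianPi n) := by
  refine integrable_comp_dotProduct_gaussianPi a (h := fun x => Real.exp (c * x)) (by fun_prop) ?_
  simp_rw [← mul_assoc]
  exact integrable_exp_mul_gaussianReal _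

theorem integral_exp_dotProduct (a : Fin n → ℝ) (c : ℝ) :
    ∫ u, Real.exp (c * (a ⬝ᵥ u)) ∂(gaussianPi n) = Real.exp (c ^ 2 * (a ⬝ᵥ a) / 2) := by
  rw [integral_comp_dotProduct_gaussianPi a (h := fun x => Real.exp (c * x)) (by fun_prop)]
  have := congrFun (mgf_id_gaussianReal (μ := 0) (v := 1)) (c * √(a ⬝ᵥ a))
  simp only [mgf, id, mul_assoc] at this
  rw [this, mul_pow, Real.sq_sqrt (dotProduct_self_nonneg_real a)]
  simp

theorem integrable_exp_dotProduct_sq {a : Fin n → ℝ} (ha : a ⬝ᵥ a ≤ 1) :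
    Integrable (fun u => Real.exp ((a ⬝ᵥ u) ^ 2 / 8)) (gaussianPi n) ∧
      ∫ u, Real.exp ((a ⬝ᵥ u) ^ 2 / 8) ∂(gaussianPi n) ≤ 2 := by
  obtain ⟨h1, h2⟩ := integrable_exp_sq_gaussianReal
  have hpt : ∀ x : ℝ, Real.exp ((√(a ⬝ᵥ a) * x) ^ 2 / 8) ≤ Real.exp (x ^ 2 / 8) := by
    intro x
    rw [mul_pow, Real.sq_sqrt (dotProduct_self_nonneg_real a)]
    gcongr
    nlinarith [sq_nonneg x]
  have hi : Integrable (fun x => Real.exp ((√(a ⬝ᵥ a) * x) ^ 2 / 8)) (gaussianReal 0 1) :=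
    h1.mono' (by fun_prop) (ae_of_all _ fun x => by
      rw [Real.norm_of_nonneg (Real.exp_pos _).le]; exact hpt x)
  refine ⟨integrable_comp_dotProduct_gaussianPi a (h := fun x => Real.exp (x ^ 2 / 8))
    (by fun_prop) hi, ?_⟩
  rw [integral_comp_dotProduct_gaussianPi a (h := fun x => Real.exp (x ^ 2 / 8)) (by fun_prop)]
  exact (integral_mono hi h1 hpt).trans h2

theorem exists_normalized_dotProduct (c : Fin n → ℝ) :
    ∃ e : Fin n → ℝ, e ⬝ᵥ e ≤ 1 ∧ ∀ u, (c ⬝ᵥ u) ^ 2 = (c ⬝ᵥ c) * (e ⬝ᵥ u) ^ 2 := by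
  by_cases hc : c = 0
  · exact ⟨0, by simp, fun u => by simp [hc]⟩
  · have hpos : 0 < c ⬝ᵥ c :=
      (dotProduct_self_nonneg_real c).lt_of_ne' fun h => hc (dotProduct_self_eq_zero.1 h)
    refine ⟨(√(c ⬝ᵥ c))⁻¹ • c, ?_, fun u => ?_⟩
    · rw [smul_dotProduct, dotProduct_smul, smul_smul, smul_eq_mul, ← mul_inv,
        Real.mul_self_sqrt hpos.le, inv_mul_cancel₀ hpos.ne']
    · rw [smul_dotProduct, smul_eq_mul, mul_pow, inv_pow, Real.sq_sqrt hpos.le, ← mul_assoc,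
        mul_inv_cancel₀ hpos.ne', one_mul]

variable (X : Matrix (Fin n) (Fin n) ℝ)

/-- The sum of the squares of the entries of a matrix, computed column by column. -/
def sumSq : ℝ := ∑ j, X.col j ⬝ᵥ X.col j

theorem sumSq_nonneg : 0 ≤ sumSq X :=
  Finset.sum_nonneg fun j _ => dotProduct_self_nonneg_real (X.col j)

theorem vecMul_dotProduct_self (u : Fin n → ℝ) :
    (u ᵥ* X) ⬝ᵥ (u ᵥ* X) = ∑ j, (X.col j ⬝ᵥ u) ^ 2 := by
  refine Finset.sum_congr rfl fun j _ => ?_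
  rw [sq, dotProduct_comm]
  rfl

theorem integrable_vecMul_sq :
    Integrable (fun u => (u ᵥ* X) ⬝ᵥ (u ᵥ* X)) (gaussianPi n) := by
  simp_rw [vecMul_dotProduct_self]
  exact integrable_finsetSum _ fun j _ => integrable_dotProduct_pow _ 2

theorem integral_vecMul_sq :
    ∫ u, (u ᵥ* X) ⬝ᵥ (u ᵥ* X) ∂(gaussianPi n) = sumSq X := by
  simp_rw [vecMul_dotProduct_self]
  rw [integral_finsetSum _ fun j _ => integrable_dotProduct_pow (X.col j) 2]
  simp_rw [integral_dotProduct_sq]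
  rfl

theorem integral_vecMul_pow_four_le :
    Integrable (fun u => ((u ᵥ* X) ⬝ᵥ (u ᵥ* X)) ^ 2) (gaussianPi n) ∧
      ∫ u, ((u ᵥ* X) ⬝ᵥ (u ᵥ* X)) ^ 2 ∂(gaussianPi n) ≤ 3 * sumSq X ^ 2 := by
  choose e he1 he using fun j => exists_normalized_dotProduct (X.col j)
  have hpt : ∀ u : Fin n → ℝ, ((u ᵥ* X) ⬝ᵥ (u ᵥ* X)) ^ 2 ≤
      sumSq X * ∑ j, (X.col j ⬝ᵥ X.col j) * (e j ⬝ᵥ u) ^ 4 := by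
    intro u
    rw [vecMul_dotProduct_self]
    refine Finset.sum_sq_le_sum_mul_sum_of_sq_le_mul _
      (fun j _ => dotProduct_self_nonneg_real (X.col j))
      (fun j _ => mul_nonneg (dotProduct_self_nonneg_real (X.col j)) (by positivity)) fun j _ => ?_
    rw [he j u]
    apply le_of_eq
    ring
  have hi : Integrable (fun u => sumSq X * ∑ j, (X.col j ⬝ᵥ X.col j) * (e j ⬝ᵥ u) ^ 4)
      (gaussianPi n) :=
    (integrable_finsetSum _ fun j _ => (integrable_dotProduct_pow _ 4).const_mul _).const_mul _
  have hi' : Integrable (fun u => ((u ᵥ* X) ⬝ᵥ (u ᵥ* X)) ^ 2) (gaussianPi n) :=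
    hi.mono' (by fun_prop) (ae_of_all _ fun u => by
      rw [Real.norm_of_nonneg (sq_nonneg _)]; exact hpt u)
  refine ⟨hi', (integral_mono hi' hi hpt).trans ?_⟩
  rw [integral_const_mul, integral_finsetSum _ fun j _ =>
    (integrable_dotProduct_pow _ 4).const_mul _]
  simp_rw [integral_const_mul, integral_dotProduct_pow_four]
  have : ∑ j, (X.col j ⬝ᵥ X.col j) * (3 * (e j ⬝ᵥ e j) ^ 2) ≤ 3 * sumSq X := by
    rw [sumSq, Finset.mul_sum]
    refine Finset.sum_le_sum fun j _ => ?_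
    have h1 := dotProduct_self_nonneg_real (X.col j)
    have h2 : (e j ⬝ᵥ e j) ^ 2 ≤ 1 := pow_le_one₀ (dotProduct_self_nonneg_real _) (he1 j)
    nlinarith
  nlinarith [sumSq_nonneg X]

theorem integral_exp_vecMul_sq_le (hX : sumSq X ≤ 1) :
    Integrable (fun u => Real.exp ((u ᵥ* X) ⬝ᵥ (u ᵥ* X) / 8)) (gaussianPi n) ∧
      ∫ u, Real.exp ((u ᵥ* X) ⬝ᵥ (u ᵥ* X) / 8) ∂(gaussianPi n) ≤ 2 := by
  choose e he1 he using fun j => exists_normalized_dotProduct (X.col j)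
  have hpt : ∀ u : Fin n → ℝ, Real.exp ((u ᵥ* X) ⬝ᵥ (u ᵥ* X) / 8) ≤
      (1 - sumSq X) + ∑ j, (X.col j ⬝ᵥ X.col j) * Real.exp ((e j ⬝ᵥ u) ^ 2 / 8) := by
    intro u
    have h := convexOn_exp.map_add_sum_le (t := Finset.univ) (w := fun j => X.col j ⬝ᵥ X.col j)
      (p := fun j => (e j ⬝ᵥ u) ^ 2 / 8) (v := 1 - sumSq X) (q := 0)
      (fun j _ => dotProduct_self_nonneg_real (X.col j)) (by simp [sumSq]) (fun _ _ => trivial)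
      (by linarith) trivial
    simp only [smul_eq_mul, mul_zero, zero_add, Real.exp_zero, mul_one] at h
    refine le_trans (le_of_eq ?_) h
    rw [vecMul_dotProduct_self, Finset.sum_div]
    congr 1
    refine Finset.sum_congr rfl fun j _ => ?_
    rw [he j u]
    ring
  have hi0 : Integrable (fun u => ∑ j, (X.col j ⬝ᵥ X.col j) * Real.exp ((e j ⬝ᵥ u) ^ 2 / 8))
      (gaussianPi n) :=
    integrable_finsetSum _ fun j _ => (integrable_exp_dotProduct_sq (he1 j)).1.const_mul _
  have hi := (integrable_const (μ := gaussianPi n) (1 - sumSq X)).add hi0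
  have hi' : Integrable (fun u => Real.exp ((u ᵥ* X) ⬝ᵥ (u ᵥ* X) / 8)) (gaussianPi n) :=
    hi.mono' (by fun_prop) (ae_of_all _ fun u => by
      rw [Real.norm_of_nonneg (Real.exp_pos _).le]; exact hpt u)
  refine ⟨hi', (integral_mono hi' hi hpt).trans ?_⟩
  simp only [Pi.add_apply]
  rw [integral_add (integrable_const _) hi0, integral_finsetSum _ fun j _ =>
    (integrable_exp_dotProduct_sq (he1 j)).1.const_mul _]
  simp_rw [integral_const_mul]
  have : ∑ j, (X.col j ⬝ᵥ X.col j) * ∫ u, Real.exp ((e j ⬝ᵥ u) ^ 2 / 8) ∂(gaussianPi n) ≤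
      sumSq X * 2 := by
    rw [sumSq, Finset.sum_mul]
    exact Finset.sum_le_sum fun j _ => mul_le_mul_of_nonneg_left
      (integrable_exp_dotProduct_sq (he1 j)).2 (dotProduct_self_nonneg_real _)
  simp
  linarith

/-- The bilinear form of `X` as a function of a pair of vectors. -/
def bilin (p : (Fin n → ℝ) × (Fin n → ℝ)) : ℝ := p.1 ⬝ᵥ X *ᵥ p.2

theorem measurable_bilin : Measurable (bilin X) := by
  unfold bilin
  fun_prop

theorem bilin_eq (u v : Fin n → ℝ) : bilin X (u, v) = (u ᵥ* X) ⬝ᵥ v := dotProduct_mulVec _ _ _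

/-- The law of a pair of independent standard Gaussian vectors. -/
abbrev gaussianPair (n : ℕ) : Measure ((Fin n → ℝ) × (Fin n → ℝ)) :=
  (gaussianPi n).prod (gaussianPi n)

theorem integral_exp_bilin_le (hX : sumSq X ≤ 1) {c : ℝ} (hc : c ^ 2 = 1 / 4) :
    Integrable (fun p => Real.exp (c * bilin X p)) (gaussianPair n) ∧
      ∫ p, Real.exp (c * bilin X p) ∂(gaussianPair n) ≤ 2 := by
  have hm := measurable_bilin X
  have hinner : ∀ u : Fin n → ℝ, ∫ v, Real.exp (c * bilin X (u, v)) ∂(gaussianPi n) =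
      Real.exp ((u ᵥ* X) ⬝ᵥ (u ᵥ* X) / 8) := by
    intro u
    simp_rw [bilin_eq]
    rw [integral_exp_dotProduct, hc]
    ring_nf
  have hi : Integrable (fun p => Real.exp (c * bilin X p)) (gaussianPair n) := by
    rw [integrable_prod_iff (by fun_prop)]
    constructor
    · refine ae_of_all _ fun u => ?_
      simp_rw [bilin_eq]
      exact integrable_exp_dotProduct _ _
    · simp_rw [Real.norm_of_nonneg (Real.exp_pos _).le, hinner]
      exact (integral_exp_vecMul_sq_le X hX).1
  refine ⟨hi, ?_⟩
  rw [integral_prod _ hi]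
  simp_rw [hinner]
  exact (integral_exp_vecMul_sq_le X hX).2

theorem integral_exp_abs_bilin_le (hX : sumSq X ≤ 1) :
    Integrable (fun p => Real.exp (|bilin X p| / 2)) (gaussianPair n) ∧
      ∫ p, Real.exp (|bilin X p| / 2) ∂(gaussianPair n) ≤ 4 := by
  have hm := measurable_bilin X
  obtain ⟨hp, hp'⟩ := integral_exp_bilin_le X hX (c := 1 / 2) (by norm_num)
  obtain ⟨hn, hn'⟩ := integral_exp_bilin_le X hX (c := -(1 / 2)) (by norm_num)
  have hpt : ∀ p, Real.exp (|bilin X p| / 2) ≤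
      Real.exp (1 / 2 * bilin X p) + Real.exp (-(1 / 2) * bilin X p) := by
    intro p
    have h1 := Real.exp_pos (1 / 2 * bilin X p)
    have h2 := Real.exp_pos (-(1 / 2) * bilin X p)
    rcases abs_cases (bilin X p) with ⟨h, -⟩ | ⟨h, -⟩ <;> rw [h]
    · rw [show bilin X p / 2 = 1 / 2 * bilin X p by ring]; linarith
    · rw [show -bilin X p / 2 = -(1 / 2) * bilin X p by ring]; linarith
  have hi : Integrable (fun p => Real.exp (|bilin X p| / 2)) (gaussianPair n) :=
    (hp.add hn).mono' (by fun_prop) (ae_of_all _ fun p => by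
      rw [Real.norm_of_nonneg (Real.exp_pos _).le]; exact hpt p)
  refine ⟨hi, (integral_mono hi (hp.add hn) hpt).trans ?_⟩
  simp only [Pi.add_apply]
  rw [integral_add hp hn]
  linarith

theorem integral_bilin_sq :
    Integrable (fun p => bilin X p ^ 2) (gaussianPair n) ∧
      ∫ p, bilin X p ^ 2 ∂(gaussianPair n) = sumSq X := by
  have hm := measurable_bilin X
  have hinner : ∀ u : Fin n → ℝ, ∫ v, bilin X (u, v) ^ 2 ∂(gaussianPi n) =
      (u ᵥ* X) ⬝ᵥ (u ᵥ* X) := by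
    intro u
    simp_rw [bilin_eq]
    exact integral_dotProduct_sq _
  have hi : Integrable (fun p => bilin X p ^ 2) (gaussianPair n) := by
    rw [integrable_prod_iff (by fun_prop)]
    constructor
    · refine ae_of_all _ fun u => ?_
      simp_rw [bilin_eq]
      exact integrable_dotProduct_pow _ 2
    · simp_rw [Real.norm_of_nonneg (sq_nonneg _), hinner]
      exact integrable_vecMul_sq X
  refine ⟨hi, ?_⟩
  rw [integral_prod _ hi]
  simp_rw [hinner]
  exact integral_vecMul_sq X

theorem integral_bilin_pow_four_le :
    Integrable (fun p => bilin X p ^ 4) (gaussianPair n) ∧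
      ∫ p, bilin X p ^ 4 ∂(gaussianPair n) ≤ 9 * sumSq X ^ 2 := by
  have hm := measurable_bilin X
  obtain ⟨hq, hq'⟩ := integral_vecMul_pow_four_le X
  have hinner : ∀ u : Fin n → ℝ, ∫ v, bilin X (u, v) ^ 4 ∂(gaussianPi n) =
      3 * ((u ᵥ* X) ⬝ᵥ (u ᵥ* X)) ^ 2 := by
    intro u
    simp_rw [bilin_eq]
    exact integral_dotProduct_pow_four _
  have hi : Integrable (fun p => bilin X p ^ 4) (gaussianPair n) := by
    rw [integrable_prod_iff (by fun_prop)]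
    constructor
    · refine ae_of_all _ fun u => ?_
      simp_rw [bilin_eq]
      exact integrable_dotProduct_pow _ 4
    · have : ∀ x : ℝ, ‖x ^ 4‖ = x ^ 4 := fun x => Real.norm_of_nonneg (by positivity)
      simp_rw [this, hinner]
      exact hq.const_mul 3
  refine ⟨hi, ?_⟩
  rw [integral_prod _ hi]
  simp_rw [hinner]
  rw [integral_const_mul]
  linarith

theorem integral_abs_bilin_mem :
    √(sumSq X) / 3 ≤ ∫ p, |bilin X p| ∂(gaussianPair n) ∧
      ∫ p, |bilin X p| ∂(gaussianPair n) ≤ √(sumSq X) := by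
  have hm := measurable_bilin X
  obtain ⟨h2i, h2⟩ := integral_bilin_sq X
  obtain ⟨h4i, h4⟩ := integral_bilin_pow_four_le X
  have h1i : Integrable (fun p => |bilin X p|) (gaussianPair n) := by
    refine ((integrable_const 1).add h2i).mono' (by fun_prop) (ae_of_all _ fun p => ?_)
    simp only [Real.norm_eq_abs, abs_abs, Pi.add_apply]
    nlinarith [sq_abs (bilin X p), sq_nonneg (|bilin X p| - 1)]
  set s := √(sumSq X) with hs
  have hs2 : s ^ 2 = sumSq X := Real.sq_sqrt (sumSq_nonneg X)
  have hs0 : 0 ≤ s := Real.sqrt_nonneg _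
  constructor
  · rcases hs0.eq_or_lt with h | hpos
    · rw [← h, zero_div]; exact integral_nonneg fun _ => abs_nonneg _
    have hpt : ∀ p, (2 * s)⁻¹ * bilin X p ^ 2 - (54 * s ^ 3)⁻¹ * bilin X p ^ 4 ≤
        |bilin X p| := by
      intro p
      rw [← sq_abs, ← Even.pow_abs (by decide : Even 4)]
      set w := |bilin X p| with hw
      have hw0 : 0 ≤ w := abs_nonneg _
      have : w - ((2 * s)⁻¹ * w ^ 2 - (54 * s ^ 3)⁻¹ * w ^ 4) =
          w * ((w - 3 * s) ^ 2 * (w + 6 * s)) / (54 * s ^ 3) := by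
        field_simp
        ring
      have h' : 0 ≤ w * ((w - 3 * s) ^ 2 * (w + 6 * s)) / (54 * s ^ 3) := by positivity
      linarith
    have := integral_mono ((h2i.const_mul _).sub (h4i.const_mul _)) h1i hpt
    refine le_trans ?_ this
    simp only [Pi.sub_apply]
    rw [integral_sub (h2i.const_mul _) (h4i.const_mul _), integral_const_mul, integral_const_mul,
      h2]
    have h5 : (54 * s ^ 3)⁻¹ * ∫ p, bilin X p ^ 4 ∂(gaussianPair n) ≤
        (54 * s ^ 3)⁻¹ * (9 * sumSq X ^ 2) := mul_le_mul_of_nonneg_left h4 (by positivity)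
    have h6 : s / 3 = (2 * s)⁻¹ * sumSq X - (54 * s ^ 3)⁻¹ * (9 * sumSq X ^ 2) := by
      rw [← hs2]
      field_simp
      ring
    linarith
  · rcases hs0.eq_or_lt with h | hpos
    · have h0 : ∫ p, bilin X p ^ 2 ∂(gaussianPair n) = 0 := by rw [h2, ← hs2, ← h]; simp
      rw [integral_eq_zero_iff_of_nonneg (fun p => sq_nonneg _) h2i] at h0
      rw [← h]
      refine (integral_eq_zero_of_ae ?_).le
      filter_upwards [h0] with p hp
      simpa using hp
    have hpt : ∀ p, |bilin X p| ≤ (2 * s)⁻¹ * bilin X p ^ 2 + s / 2 := by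
      intro p
      rw [← sq_abs]
      set w := |bilin X p|
      have : (2 * s)⁻¹ * w ^ 2 + s / 2 - w = (w - s) ^ 2 / (2 * s) := by
        field_simp
        ring
      have h' : 0 ≤ (w - s) ^ 2 / (2 * s) := by positivity
      linarith
    refine (integral_mono h1i ((h2i.const_mul _).add (integrable_const _)) hpt).trans ?_
    simp only [Pi.add_apply]
    rw [integral_add (h2i.const_mul _) (integrable_const _), integral_const_mul, h2, ← hs2]
    simp
    field_simp
    linarith

end Pi

section Net

variable {E F H : Type*} [NormedAddCommGroup E] [NormedSpace ℝ E] [NormedAddCommGroup F]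
  [NormedSpace ℝ F] [AddCommGroup H] [Module ℝ H]

theorem bilinear_le_of_le_on_unitBalls (β : E →ₗ[ℝ] F →ₗ[ℝ] H) (p : Seminorm ℝ H) {S : ℝ}
    (h : ∀ x y, ‖x‖ ≤ 1 → ‖y‖ ≤ 1 → p (β x y) ≤ S) (x : E) (y : F) :
    p (β x y) ≤ S * (‖x‖ * ‖y‖) := by
  rcases eq_or_ne x 0 with rfl | hx
  · simp
  rcases eq_or_ne y 0 with rfl | hy
  · simp
  have hx' := norm_pos_iff.2 hx
  have hy' := norm_pos_iff.2 hy
  have := h (‖x‖⁻¹ • x) (‖y‖⁻¹ • y) (by simp [norm_smul, hx'.ne'])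
    (by simp [norm_smul, hy'.ne'])
  rw [LinearMap.map_smul, LinearMap.map_smul, LinearMap.smul_apply, map_smul_eq_mul, map_smul_eq_mul, norm_inv,
    norm_inv, norm_norm, norm_norm] at this
  calc p (β x y) = ‖y‖⁻¹ * (‖x‖⁻¹ * p (β x y)) * (‖x‖ * ‖y‖) := by field_simp
    _ ≤ S * (‖x‖ * ‖y‖) := by gcongr

theorem bilinear_sub_eq (β : E →ₗ[ℝ] F →ₗ[ℝ] H) (x a : E) (y b : F) :
    β x y - β a b = β (x - a) y + β a (y - b) := by
  simp

theorem bilinear_sub_le (β : E →ₗ[ℝ] F →ₗ[ℝ] H) (p : Seminorm ℝ H) {S ε : ℝ} (hS : 0 ≤ S)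
    (h : ∀ x y, p (β x y) ≤ S * (‖x‖ * ‖y‖)) {x a : E} {y b : F}
    (hy : ‖y‖ ≤ 1) (ha : ‖a‖ ≤ 1) (hxa : ‖x - a‖ ≤ ε) (hyb : ‖y - b‖ ≤ ε) :
    p (β x y - β a b) ≤ 2 * ε * S := by
  rw [bilinear_sub_eq]
  have h1 : ‖x - a‖ * ‖y‖ ≤ ε * 1 := by
    gcongr
    exact (norm_nonneg _).trans hxa
  have h2 : ‖a‖ * ‖y - b‖ ≤ 1 * ε := by gcongr
  calc p (β (x - a) y + β a (y - b)) ≤ p (β (x - a) y) + p (β a (y - b)) := map_add_le_add _ _ _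
    _ ≤ S * (ε * 1) + S * (1 * ε) := add_le_add ((h _ _).trans (by gcongr)) ((h _ _).trans (by gcongr))
    _ = 2 * ε * S := by ring

theorem bilinear_bounds_of_net (β : E →ₗ[ℝ] F →ₗ[ℝ] H) (N p : Seminorm ℝ H)
    (hN : ∀ x y, N (β x y) ≤ ‖x‖ * ‖y‖) {K : ℝ} (hK : ∀ x y, p (β x y) ≤ K * (‖x‖ * ‖y‖))
    {A : Finset E} {B : Finset F} {ε t : ℝ} (hε : 0 ≤ ε) (hε' : 2 * ε < 1) (ht : 0 ≤ t)
    (hA1 : ∀ a ∈ A, ‖a‖ ≤ 1) (hA : ∀ x, ‖x‖ ≤ 1 → ∃ a ∈ A, ‖x - a‖ ≤ ε)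
    (hB1 : ∀ b ∈ B, ‖b‖ ≤ 1) (hB : ∀ y, ‖y‖ ≤ 1 → ∃ b ∈ B, ‖y - b‖ ≤ ε)
    (h : ∀ a ∈ A, ∀ b ∈ B, N (β a b) / 3 - t ≤ p (β a b) ∧ p (β a b) ≤ N (β a b) + t)
    {x : E} {y : F} (hx : ‖x‖ ≤ 1) (hy : ‖y‖ ≤ 1) :
    (N (β x y) - 2 * ε) / 3 - t - 2 * ε * ((1 + t) / (1 - 2 * ε)) ≤ p (β x y) ∧
      p (β x y) ≤ (1 + t) / (1 - 2 * ε) := by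
  set T : Set ℝ := {S | 0 ≤ S ∧ ∀ x y, p (β x y) ≤ S * (‖x‖ * ‖y‖)} with hT
  have hTne : T.Nonempty := ⟨max K 0, le_max_right _ _, fun x y => (hK x y).trans (by
    gcongr; exact le_max_left _ _)⟩
  have hTbdd : BddBelow T := ⟨0, fun S hS => hS.1⟩
  have hTstep : ∀ S ∈ T, 1 + t + 2 * ε * S ∈ T := by
    rintro S ⟨hS0, hS⟩
    refine ⟨by positivity, bilinear_le_of_le_on_unitBalls β p fun x y hx hy => ?_⟩
    obtain ⟨a, ha, hxa⟩ := hA x hx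
    obtain ⟨b, hb, hyb⟩ := hB y hy
    have h1 := bilinear_sub_le β p hS0 hS hy (hA1 a ha) hxa hyb
    have h2 : p (β x y) ≤ p (β x y - β a b) + p (β a b) := by
      simpa using map_add_le_add p (β x y - β a b) (β a b)
    have h3 : N (β a b) ≤ 1 := (hN a b).trans
      (mul_le_one₀ (hA1 a ha) (norm_nonneg _) (hB1 b hb))
    linarith [(h a ha b hb).2]
  have hmem : sInf T ∈ T := by
    refine ⟨Real.sInf_nonneg fun S hS => hS.1, bilinear_le_of_le_on_unitBalls β p
      fun x y hx hy => le_csInf hTne fun S hS => (hS.2 x y).trans ?_⟩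
    exact mul_le_of_le_one_right hS.1 (mul_le_one₀ hx (norm_nonneg _) hy)
  have hle : sInf T ≤ (1 + t) / (1 - 2 * ε) := by
    rw [le_div_iff₀ (by linarith)]
    linarith [csInf_le hTbdd (hTstep _ hmem)]
  obtain ⟨a, ha, hxa⟩ := hA x hx
  obtain ⟨b, hb, hyb⟩ := hB y hy
  constructor
  · have h1 := bilinear_sub_le β p hmem.1 hmem.2 hy (hA1 a ha) hxa hyb
    have h2 : p (β a b) ≤ p (β x y - β a b) + p (β x y) := by
      rw [map_sub_rev]
      simpa using map_add_le_add p (β a b - β x y) (β x y)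
    have h3 := bilinear_sub_le β N zero_le_one (fun x y => by simpa using hN x y) hy (hA1 a ha)
      hxa hyb
    have h4 : N (β x y) ≤ N (β x y - β a b) + N (β a b) := by
      simpa using map_add_le_add N (β x y - β a b) (β a b)
    have h5 : 2 * ε * sInf T ≤ 2 * ε * ((1 + t) / (1 - 2 * ε)) := by gcongr
    linarith [(h a ha b hb).1]
  · refine (hmem.2 x y).trans (le_trans ?_ hle)
    exact mul_le_of_le_one_right hmem.1 (mul_le_one₀ hx (norm_nonneg _) hy)

theorem exists_net_parameter {C₁ C₂ : ℝ} (hC₁ : C₁ < 1 / 3) (hC₂ : 1 < C₂) :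
    ∃ ε : ℝ, 0 < ε ∧ ε ≤ 1 / 4 ∧ (1 + ε) / (1 - 2 * ε) ≤ C₂ ∧
      C₁ ≤ (1 - 2 * ε) / 3 - ε - 2 * ε * ((1 + ε) / (1 - 2 * ε)) := by
  obtain ⟨η, h0, h1, h2, h3⟩ : ∃ η : ℝ, 0 < η ∧ η ≤ 1 ∧ η ≤ C₂ - 1 ∧ η ≤ 1 / 3 - C₁ :=
    ⟨min 1 (min (C₂ - 1) (1 / 3 - C₁)), by simp; constructor <;> linarith, by simp, by simp,
      by simp⟩
  have hS : (1 + η / 10) / (1 - 2 * (η / 10)) ≤ 1 + η := by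
    rw [div_le_iff₀ (by linarith)]
    nlinarith
  refine ⟨η / 10, by positivity, by linarith, by linarith, ?_⟩
  have : 2 * (η / 10) * ((1 + η / 10) / (1 - 2 * (η / 10))) ≤ 2 * (η / 10) * 2 := by
    gcongr
    linarith
  linarith

end Net

section Factor

variable {n R : ℕ}

/-- The matrix whose `j`-th column is the image of the `j`-th component of `Y` under `P`. -/
def factorMatrix (n R : ℕ) : (EuclideanSpace ℝ (Fin R) →L[ℝ] EuclideanSpace ℝ (Fin n)) →ₗ[ℝ]
    (PiLp 2 fun _ : Fin n => EuclideanSpace ℝ (Fin R)) →ₗ[ℝ] Matrix (Fin n) (Fin n) ℝ :=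
  LinearMap.mk₂ ℝ (fun P Y => Matrix.of fun i j => P (Y j) i)
    (fun _ _ _ => by ext; simp) (fun _ _ _ => by ext; simp)
    (fun _ _ _ => by ext; simp) (fun _ _ _ => by ext; simp)

theorem factorMatrix_apply (P : EuclideanSpace ℝ (Fin R) →L[ℝ] EuclideanSpace ℝ (Fin n))
    (Y : PiLp 2 fun _ : Fin n => EuclideanSpace ℝ (Fin R)) (i j : Fin n) :
    factorMatrix n R P Y i j = P (Y j) i := rfl

attribute [local instance] Matrix.frobeniusNormedAddCommGroup Matrix.frobeniusNormedSpace

/-- The Frobenius norm as a seminorm. -/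
def frobSeminorm (n : ℕ) : Seminorm ℝ (Matrix (Fin n) (Fin n) ℝ) := normSeminorm ℝ _

theorem frobSeminorm_apply (X : Matrix (Fin n) (Fin n) ℝ) :
    frobSeminorm n X = √(∑ i, ∑ j, X i j ^ 2) := by
  change ‖X‖ = _
  rw [Matrix.frobenius_norm_def, Real.sqrt_eq_rpow]
  simp

theorem frobSeminorm_factorMatrix_le
    (P : EuclideanSpace ℝ (Fin R) →L[ℝ] EuclideanSpace ℝ (Fin n))
    (Y : PiLp 2 fun _ : Fin n => EuclideanSpace ℝ (Fin R)) :
    frobSeminorm n (factorMatrix n R P Y) ≤ ‖P‖ * ‖Y‖ := by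
  rw [frobSeminorm_apply, Finset.sum_comm, PiLp.norm_eq_of_L2, ← Real.sqrt_sq (norm_nonneg P),
    ← Real.sqrt_mul (sq_nonneg _), Finset.mul_sum]
  refine Real.sqrt_le_sqrt (Finset.sum_le_sum fun j _ => ?_)
  have h := pow_le_pow_left₀ (norm_nonneg _) (P.le_opNorm (Y j)) 2
  rw [EuclideanSpace.norm_sq_eq, mul_pow] at h
  simpa [factorMatrix_apply] using h

theorem exists_linearIsometry_euclideanSpace {V : Type*} [NormedAddCommGroup V]
    [InnerProductSpace ℝ V] [FiniteDimensional ℝ V] (h : Module.finrank ℝ V ≤ R) :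
    Nonempty (V →ₗᵢ[ℝ] EuclideanSpace ℝ (Fin R)) := by
  let b := stdOrthonormalBasis ℝ V
  let e : Fin (Module.finrank ℝ V) → EuclideanSpace ℝ (Fin R) :=
    fun i => EuclideanSpace.basisFun (Fin R) ℝ (Fin.castLE h i)
  have he : Orthonormal ℝ e :=
    (EuclideanSpace.basisFun (Fin R) ℝ).orthonormal.comp _ (Fin.castLE_injective h)
  have hb : Orthonormal ℝ b.toBasis := by simp [b.orthonormal]
  refine ⟨(b.toBasis.constr ℝ e).isometryOfOrthonormal hb ?_⟩
  convert he using 1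
  ext1 i
  simp

theorem exists_factorMatrix_eq (X : Matrix (Fin n) (Fin n) ℝ) (hX : X.rank ≤ R) :
    ∃ P Y, ‖P‖ ≤ 1 ∧ ‖Y‖ = frobSeminorm n X ∧ factorMatrix n R P Y = X := by
  set L := Matrix.toEuclideanLin X with hL
  set V := LinearMap.range L with hV
  have hfr : Module.finrank ℝ V ≤ R := by
    refine le_trans (le_of_eq ?_) hX
    rw [Matrix.rank_eq_finrank_range_toLin X (EuclideanSpace.basisFun (Fin n) ℝ).toBasis (EuclideanSpace.basisFun (Fin n) ℝ).toBasis]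
    rfl
  obtain ⟨J⟩ := exists_linearIsometry_euclideanSpace hfr
  set y : Fin n → V := fun j => L.rangeRestrict (EuclideanSpace.single j 1)
  have hy : ∀ i j, (y j : EuclideanSpace ℝ (Fin n)) i = X i j := by
    intro i j
    simp [y, hL]
  refine ⟨V.subtypeL ∘L ContinuousLinearMap.adjoint J.toContinuousLinearMap,
    WithLp.toLp 2 fun j => J (y j), ?_, ?_, ?_⟩
  · refine (ContinuousLinearMap.opNorm_comp_le _ _).trans ?_
    rw [LinearIsometryEquiv.norm_map]
    exact mul_le_one₀ (Submodule.norm_subtypeL_le _) (by positivity)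
      J.norm_toContinuousLinearMap_le
  · rw [PiLp.norm_eq_of_L2, frobSeminorm_apply, Finset.sum_comm]
    congr 1
    refine Finset.sum_congr rfl fun j _ => ?_
    simp only [J.norm_map]
    rw [← Submodule.norm_coe, EuclideanSpace.norm_sq_eq]
    simp [hy]
  · ext i j
    rw [factorMatrix_apply, ← hy i j]
    have : ContinuousLinearMap.adjoint J.toContinuousLinearMap (J (y j)) = y j := by
      refine ext_inner_left ℝ fun v => ?_
      rw [ContinuousLinearMap.adjoint_inner_right]
      exact J.inner_map_map _ _
    simp [this]

end Factor

section Pairing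

theorem measurePreserving_comp_injective {ι κ α : Type*} [Fintype ι] [Fintype κ]
    [MeasurableSpace α] (μ : Measure α) [IsProbabilityMeasure μ] {g : κ → ι}
    (hg : Function.Injective g) :
    MeasurePreserving (fun (z : ι → α) k => z (g k)) (Measure.pi fun _ => μ)
      (Measure.pi fun _ => μ) := by
  have h : iIndepFun (fun i (z : ι → α) => z i) (Measure.pi fun _ => μ) :=
    iIndepFun_pi (X := fun _ => id) fun _ => aemeasurable_id
  refine ⟨by fun_prop, ?_⟩
  have h2 := h.precomp hg
  rw [iIndepFun_iff_map_fun_eq_pi_map (fun k => (measurable_pi_apply (g k)).aemeasurable)] at h2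
  rw [h2]
  congr 1
  ext1 k
  exact (measurePreserving_eval (fun _ => μ) (g k)).map_eq

theorem measurePreserving_pairing {ι κ α : Type*} [Fintype ι] [Fintype κ]
    [MeasurableSpace α] (μ : Measure α) [IsProbabilityMeasure μ] {f g : κ → ι}
    (h : Function.Injective (Sum.elim f g)) :
    MeasurePreserving (fun (z : ι → α) k => (z (f k), z (g k))) (Measure.pi fun _ => μ)
      (Measure.pi fun _ => μ.prod μ) :=
  ((measurePreserving_arrowProdEquivProdArrow α α κ (fun _ => μ) fun _ => μ).symm.comp
    (measurePreserving_sumPiEquivProdPi fun _ : κ ⊕ κ => μ)).comp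
      (measurePreserving_comp_injective μ h)

variable {n : ℕ}

theorem measurePreserving_rotation_gaussianPi (θ : ℝ) :
    MeasurePreserving (ContinuousLinearMap.rotation θ :
      (Fin n → ℝ) × (Fin n → ℝ) →L[ℝ] (Fin n → ℝ) × (Fin n → ℝ))
      (gaussianPair n) (gaussianPair n) := by
  have := isGaussian_gaussianPi n
  refine ⟨by fun_prop, IsGaussian.map_rotation_eq_self ?_ θ⟩
  ext i
  rw [eval_integral fun j => (IsGaussian.integrable_id (μ := gaussianPi n)).eval j]
  have h := (measurePreserving_eval (fun _ : Fin n => gaussianReal 0 1) i).map_eq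
  have h2 := integral_map (μ := gaussianPi n) (φ := Function.eval i) (f := id)
    (measurable_pi_apply i).aemeasurable (by fun_prop)
  rw [h] at h2
  simpa using h2.symm

theorem bilin_rotation {X : Matrix (Fin n) (Fin n) ℝ} (hX : X.IsHermitian) (u v : Fin n → ℝ) :
    |bilin X (ContinuousLinearMap.rotation (Real.pi / 4) (u, v))| =
      |(u ⬝ᵥ X *ᵥ u - v ⬝ᵥ X *ᵥ v) / 2| := by
  have hs : u ⬝ᵥ X *ᵥ v = v ⬝ᵥ X *ᵥ u := by
    rw [dotProduct_mulVec, ← mulVec_transpose, dotProduct_comm]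
    have : Xᵀ = X := by simpa using hX.eq
    rw [this]
  rw [← abs_neg]
  congr 1
  have h2 : (√2 / 2) * (√2 / 2) = 1 / (2 : ℝ) := by
    rw [div_mul_div_comm, Real.mul_self_sqrt zero_le_two]; norm_num
  simp only [bilin, ContinuousLinearMap.rotation_apply, Real.cos_pi_div_four,
    Real.sin_pi_div_four, mulVec_add, mulVec_smul, add_dotProduct, dotProduct_add,
    smul_dotProduct, dotProduct_smul, smul_eq_mul, hs]
  linear_combination (u ⬝ᵥ X *ᵥ u - v ⬝ᵥ X *ᵥ v) * h2

/-- Group the first `2 * (m / 2)` vectors in consecutive pairs and rotate each pair. -/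
def rotatedPairs (m n : ℕ) (z : Fin m → Fin n → ℝ) (i : Fin (m / 2)) :
    (Fin n → ℝ) × (Fin n → ℝ) :=
  ContinuousLinearMap.rotation (Real.pi / 4)
    (z ⟨2 * i, by have := i.2; omega⟩, z ⟨2 * i + 1, by have := i.2; omega⟩)

theorem measurePreserving_rotatedPairs (m n : ℕ) :
    MeasurePreserving (rotatedPairs m n) (Measure.pi fun _ => gaussianPi n)
      (Measure.pi fun _ => gaussianPair n) := by
  refine (measurePreserving_pi _ _ fun _ =>
    measurePreserving_rotation_gaussianPi (Real.pi / 4)).comp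
      (measurePreserving_pairing (gaussianPi n)
        (f := fun i : Fin (m / 2) => (⟨2 * i, by have := i.2; omega⟩ : Fin m))
        (g := fun i : Fin (m / 2) => ⟨2 * i + 1, by have := i.2; omega⟩) ?_)
  rintro (i | i) (j | j) h <;> simp [Fin.ext_iff] at h ⊢ <;> omega

theorem abs_sensingAsym {m : ℕ} (z : Fin m → Fin n → ℝ) {X : Matrix (Fin n) (Fin n) ℝ}
    (hX : X.IsHermitian) (i : Fin (m / 2)) :
    |sensingAsym z X i| = |bilin X (rotatedPairs m n z i)| :=
  (bilin_rotation hX _ _).symm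

end Pairing

section Empirical

variable {n M : ℕ}

theorem frobSeminorm_eq_sqrt_sumSq (X : Matrix (Fin n) (Fin n) ℝ) :
    frobSeminorm n X = √(sumSq X) := by
  rw [frobSeminorm_apply, sumSq, Finset.sum_comm]
  simp [dotProduct, sq]

/-- The empirical mean of `|uᵢᵀ X vᵢ|`, as a seminorm in `X`. -/
def empSeminorm (w : Fin M → (Fin n → ℝ) × (Fin n → ℝ)) :
    Seminorm ℝ (Matrix (Fin n) (Fin n) ℝ) :=
  Seminorm.of (fun X => (M : ℝ)⁻¹ * ∑ i, |bilin X (w i)|)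
    (fun X Y => by
      rw [← mul_add, ← Finset.sum_add_distrib]
      gcongr with i
      simp only [bilin, add_mulVec, dotProduct_add]
      exact abs_add_le _ _)
    (fun a X => by
      simp only [bilin, smul_mulVec, dotProduct_smul, smul_eq_mul, abs_mul, Real.norm_eq_abs,
        ← Finset.mul_sum]
      ring)

theorem empSeminorm_apply (w : Fin M → (Fin n → ℝ) × (Fin n → ℝ))
    (X : Matrix (Fin n) (Fin n) ℝ) :
    empSeminorm w X = (M : ℝ)⁻¹ * ∑ i, |bilin X (w i)| := rfl

theorem exists_seminorm_le_mul_frobSeminorm (p : Seminorm ℝ (Matrix (Fin n) (Fin n) ℝ)) :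
    ∃ K, 0 ≤ K ∧ ∀ X, p X ≤ K * frobSeminorm n X := by
  refine ⟨∑ i, ∑ j, p (Matrix.single i j 1),
    Finset.sum_nonneg fun i _ => Finset.sum_nonneg fun j _ => apply_nonneg _ _, fun X => ?_⟩
  have hX : ∀ i j, |X i j| ≤ frobSeminorm n X := by
    intro i j
    rw [frobSeminorm_apply, ← Real.sqrt_sq_eq_abs]
    refine Real.sqrt_le_sqrt ?_
    refine le_trans ?_ (Finset.single_le_sum (f := fun i => ∑ j, X i j ^ 2)
      (fun i _ => Finset.sum_nonneg fun j _ => sq_nonneg _) (Finset.mem_univ i))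
    exact Finset.single_le_sum (f := fun j => X i j ^ 2)
      (fun j _ => sq_nonneg _) (Finset.mem_univ j)
  conv_lhs => rw [Matrix.matrix_eq_sum_single X]
  have hsub : ∀ (f : Fin n → Matrix (Fin n) (Fin n) ℝ), p (∑ i, f i) ≤ ∑ i, p (f i) :=
    fun f => Finset.le_sum_of_subadditive p (map_zero p).le (map_add_le_add p) _ _
  refine (hsub _).trans ?_
  rw [Finset.sum_mul]
  refine Finset.sum_le_sum fun i _ => (hsub _).trans ?_
  rw [Finset.sum_mul]
  refine Finset.sum_le_sum fun j _ => ?_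
  have : Matrix.single i j (X i j) = X i j • Matrix.single i j (1 : ℝ) := by simp
  rw [this, map_smul_eq_mul, mul_comm]
  exact mul_le_mul_of_nonneg_left (hX i j) (apply_nonneg _ _)

end Empirical

section UniformBound

variable {n M R : ℕ}

theorem finrank_continuousLinearMap_euclideanSpace (n R : ℕ) :
    Module.finrank ℝ (EuclideanSpace ℝ (Fin R) →L[ℝ] EuclideanSpace ℝ (Fin n)) = n * R := by
  rw [← LinearEquiv.finrank_eq (LinearMap.toContinuousLinearMap (𝕜 := ℝ)
    (E := EuclideanSpace ℝ (Fin R)) (F' := EuclideanSpace ℝ (Fin n)))]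
  simp [Module.finrank_linearMap, mul_comm]

theorem finrank_piLp_euclideanSpace (n R : ℕ) :
    Module.finrank ℝ (PiLp 2 fun _ : Fin n => EuclideanSpace ℝ (Fin R)) = n * R := by
  refine (LinearEquiv.finrank_eq
    (WithLp.linearEquiv 2 ℝ (Fin n → EuclideanSpace ℝ (Fin R)))).trans ?_
  rw [Module.finrank_pi_fintype]
  simp

theorem measurable_empSeminorm (X : Matrix (Fin n) (Fin n) ℝ) :
    Measurable fun w : Fin M → (Fin n → ℝ) × (Fin n → ℝ) => empSeminorm w X := by
  have := measurable_bilin X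
  simp only [empSeminorm_apply]
  fun_prop

theorem measureReal_empSeminorm_deviation_le {X : Matrix (Fin n) (Fin n) ℝ}
    (hX : frobSeminorm n X ≤ 1) (hM : 0 < M) {ε : ℝ} (hε : 0 < ε) (hε' : ε ≤ 1 / 4) :
    (Measure.pi fun _ : Fin M => gaussianPair n).real
      {w | ε < |empSeminorm w X - ∫ p, |bilin X p| ∂(gaussianPair n)|} ≤
        2 * Real.exp (-(M * (ε ^ 2 / 512))) := by
  have hm := measurable_bilin X
  have hX' : sumSq X ≤ 1 := by
    rw [frobSeminorm_eq_sqrt_sumSq] at hX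
    simpa using hX
  obtain ⟨h1, h2⟩ := integral_exp_abs_bilin_le X hX'
  obtain ⟨h3, h4⟩ := integral_bilin_sq X
  have := measureReal_pi_deviation_le (ρ := gaussianPair n) (f := fun p => |bilin X p|)
    (by fun_prop) (fun _ => abs_nonneg _) h1 h2 (by simpa using h3)
    (by simpa [h4] using hX') hM (s := ε / 256) (t := ε) (by positivity) (by linarith)
    (by linarith)
  refine this.trans (le_of_eq ?_)
  ring_nf

theorem empSeminorm_bounds_of_net {A : Finset (EuclideanSpace ℝ (Fin R) →L[ℝ]
      EuclideanSpace ℝ (Fin n))} {B : Finset (PiLp 2 fun _ : Fin n => EuclideanSpace ℝ (Fin R))}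
    {ε : ℝ} (hε : 0 < ε) (hε' : ε ≤ 1 / 4)
    (hA1 : ∀ a ∈ A, ‖a‖ ≤ 1) (hA : ∀ x, ‖x‖ ≤ 1 → ∃ a ∈ A, ‖x - a‖ ≤ ε)
    (hB1 : ∀ b ∈ B, ‖b‖ ≤ 1) (hB : ∀ y, ‖y‖ ≤ 1 → ∃ b ∈ B, ‖y - b‖ ≤ ε)
    {w : Fin M → (Fin n → ℝ) × (Fin n → ℝ)}
    (h : ∀ a ∈ A, ∀ b ∈ B, |empSeminorm w (factorMatrix n R a b) -
      ∫ p, |bilin (factorMatrix n R a b) p| ∂(gaussianPair n)| ≤ ε)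
    {X : Matrix (Fin n) (Fin n) ℝ} (hX : X ≠ 0) (hXR : X.rank ≤ R) :
    0 < frobSeminorm n X ∧
    (1 - 2 * ε) / 3 - ε - 2 * ε * ((1 + ε) / (1 - 2 * ε)) ≤
      empSeminorm w X / frobSeminorm n X ∧
    empSeminorm w X / frobSeminorm n X ≤ (1 + ε) / (1 - 2 * ε) := by
  have hpos : 0 < frobSeminorm n X := by
    rw [frobSeminorm_eq_sqrt_sumSq, Real.sqrt_pos]
    refine (sumSq_nonneg X).lt_of_ne' fun h0 => hX ?_
    rw [sumSq, Finset.sum_eq_zero_iff_of_nonneg fun j _ => dotProduct_self_nonneg_real _] at h0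
    ext i j
    exact congrFun (dotProduct_self_eq_zero.1 (h0 j (Finset.mem_univ j))) i
  refine ⟨hpos, ?_⟩
  obtain ⟨P, Y, hP, hY, rfl⟩ := exists_factorMatrix_eq X hXR
  obtain ⟨K, hK0, hK⟩ := exists_seminorm_le_mul_frobSeminorm (empSeminorm w)
  set N := frobSeminorm n (factorMatrix n R P Y) with hN
  have key := bilinear_bounds_of_net (factorMatrix n R) (frobSeminorm n) (empSeminorm w)
    frobSeminorm_factorMatrix_le
    (fun x y => (hK _).trans (mul_le_mul_of_nonneg_left (frobSeminorm_factorMatrix_le x y) hK0))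
    hε.le (by linarith) hε.le hA1 hA hB1 hB (fun a ha b hb => ?_) hP
    (y := N⁻¹ • Y) (by rw [norm_smul, hY, norm_inv, Real.norm_of_nonneg hpos.le,
      inv_mul_cancel₀ hpos.ne'])
  · rw [map_smul, map_smul_eq_mul, map_smul_eq_mul, norm_inv, Real.norm_of_nonneg hpos.le, ← hN,
      inv_mul_cancel₀ hpos.ne', inv_mul_eq_div] at key
    exact key
  · obtain ⟨h1, h2⟩ := integral_abs_bilin_mem (factorMatrix n R a b)
    rw [← frobSeminorm_eq_sqrt_sumSq] at h1 h2
    have h3 := abs_le.1 (h a ha b hb)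
    constructor <;> linarith

theorem hasSRUB_of_empSeminorm {m : ℕ} {z : Fin m → Fin n → ℝ} {C₁ C₂ : ℝ}
    (h : ∀ X : Matrix (Fin n) (Fin n) ℝ, X ≠ 0 → X.rank ≤ R →
      C₁ ≤ empSeminorm (rotatedPairs m n z) X / frobSeminorm n X ∧
      empSeminorm (rotatedPairs m n z) X / frobSeminorm n X ≤ C₂) : HasSRUB z R C₁ C₂ := by
  intro X hX hX0 hXR
  have h1 : l1Norm (sensingAsym z X) / ((m / 2 : ℕ) : ℝ) =
      empSeminorm (rotatedPairs m n z) X := by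
    rw [empSeminorm_apply, l1Norm, div_eq_inv_mul]
    simp_rw [abs_sensingAsym z hX]
  have h2 : frobNorm X = frobSeminorm n X := (frobSeminorm_apply X).symm
  rw [h1, h2]
  exact h X hX0 hXR

/-- The event that some matrix generated by the nets `A` and `B` has an empirical mean that is
`ε`-far from its expectation. -/
def netDeviation (M : ℕ) (A : Finset (EuclideanSpace ℝ (Fin R) →L[ℝ] EuclideanSpace ℝ (Fin n)))
    (B : Finset (PiLp 2 fun _ : Fin n => EuclideanSpace ℝ (Fin R))) (ε : ℝ) :
    Set (Fin M → (Fin n → ℝ) × (Fin n → ℝ)) :=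
  ⋃ q ∈ A ×ˢ B, {w | ε < |empSeminorm w (factorMatrix n R q.1 q.2) -
    ∫ p, |bilin (factorMatrix n R q.1 q.2) p| ∂(gaussianPair n)|}

theorem measurableSet_netDeviation
    (A : Finset (EuclideanSpace ℝ (Fin R) →L[ℝ] EuclideanSpace ℝ (Fin n)))
    (B : Finset (PiLp 2 fun _ : Fin n => EuclideanSpace ℝ (Fin R))) (ε : ℝ) :
    MeasurableSet (netDeviation M A B ε) := by
  refine Finset.measurableSet_biUnion _ fun q _ => ?_
  have := measurable_empSeminorm (M := M) (factorMatrix n R q.1 q.2)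
  exact measurableSet_lt measurable_const (by fun_prop)

theorem measureReal_netDeviation_le
    {A : Finset (EuclideanSpace ℝ (Fin R) →L[ℝ] EuclideanSpace ℝ (Fin n))}
    {B : Finset (PiLp 2 fun _ : Fin n => EuclideanSpace ℝ (Fin R))} {ε : ℝ}
    (hε : 0 < ε) (hε' : ε ≤ 1 / 4) (hM : 0 < M)
    (hA1 : ∀ a ∈ A, ‖a‖ ≤ 1) (hB1 : ∀ b ∈ B, ‖b‖ ≤ 1)
    (hA : (A.card : ℝ) ≤ (1 + 2 / ε) ^ (n * R)) (hB : (B.card : ℝ) ≤ (1 + 2 / ε) ^ (n * R)) :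
    (Measure.pi fun _ : Fin M => gaussianPair n).real (netDeviation M A B ε) ≤
      Real.exp (2 * (n * R) * Real.log (1 + 2 / ε) + 1 - M * (ε ^ 2 / 512)) := by
  have h1 : (Measure.pi fun _ : Fin M => gaussianPair n).real (netDeviation M A B ε) ≤
      ∑ q ∈ A ×ˢ B, 2 * Real.exp (-(M * (ε ^ 2 / 512))) := by
    refine (measureReal_biUnion_finset_le _ _).trans (Finset.sum_le_sum fun q hq => ?_)
    rw [Finset.mem_product] at hq
    exact measureReal_empSeminorm_deviation_le ((frobSeminorm_factorMatrix_le _ _).trans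
      (mul_le_one₀ (hA1 _ hq.1) (norm_nonneg _) (hB1 _ hq.2))) hM hε hε'
  refine h1.trans ?_
  rw [Finset.sum_const, Finset.card_product, nsmul_eq_mul, Nat.cast_mul]
  have hpos : 0 < 1 + 2 / ε := by positivity
  have h2 : (2 : ℝ) ≤ Real.exp 1 := by linarith [Real.add_one_le_exp 1]
  calc (A.card : ℝ) * B.card * (2 * Real.exp (-(M * (ε ^ 2 / 512))))
      ≤ (1 + 2 / ε) ^ (n * R) * (1 + 2 / ε) ^ (n * R) *
        (Real.exp 1 * Real.exp (-(M * (ε ^ 2 / 512)))) := by gcongr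
    _ = _ := by
      nth_rewrite 1 2 [← Real.exp_log hpos]
      rw [← Real.exp_nat_mul, ← Real.exp_add, ← Real.exp_add, ← Real.exp_add]
      congr 1
      push_cast
      ring

theorem ofReal_le_measure_hasSRUB {m : ℕ} (hm : 2 ≤ m) {C₁ C₂ ε : ℝ} (hε : 0 < ε)
    (hε' : ε ≤ 1 / 4) (hC₁ : C₁ ≤ (1 - 2 * ε) / 3 - ε - 2 * ε * ((1 + ε) / (1 - 2 * ε)))
    (hC₂ : (1 + ε) / (1 - 2 * ε) ≤ C₂) :
    ENNReal.ofReal (1 - Real.exp (2 * (n * R) * Real.log (1 + 2 / ε) + 1 -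
      (m / 2 : ℕ) * (ε ^ 2 / 512))) ≤
        Measure.pi (fun _ : Fin m => gaussianPi n) {z | HasSRUB z R C₁ C₂} := by
  obtain ⟨A, hAc, hA1, hA⟩ := exists_finset_net_closedBall
    (EuclideanSpace ℝ (Fin R) →L[ℝ] EuclideanSpace ℝ (Fin n)) hε
  obtain ⟨B, hBc, hB1, hB⟩ := exists_finset_net_closedBall
    (PiLp 2 fun _ : Fin n => EuclideanSpace ℝ (Fin R)) hε
  rw [finrank_continuousLinearMap_euclideanSpace] at hAc
  rw [finrank_piLp_euclideanSpace] at hBc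
  have hbad := measureReal_netDeviation_le (M := m / 2) hε hε' (by omega) hA1 hB1 hAc hBc
  have hms := measurableSet_netDeviation (M := m / 2) A B ε
  have hsub : rotatedPairs m n ⁻¹' (netDeviation (m / 2) A B ε)ᶜ ⊆ {z | HasSRUB z R C₁ C₂} := by
    intro z hz
    refine hasSRUB_of_empSeminorm fun X hX hXR => ?_
    obtain ⟨-, h1, h2⟩ := empSeminorm_bounds_of_net hε hε' hA1 hA hB1 hB
      (w := rotatedPairs m n z) (fun a ha b hb => le_of_not_gt fun hlt =>
        hz (Set.mem_iUnion₂.2 ⟨(a, b), Finset.mk_mem_product ha hb, hlt⟩)) hX hXR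
    exact ⟨hC₁.trans h1, h2.trans hC₂⟩
  refine le_trans ?_ (measure_mono hsub)
  rw [(measurePreserving_rotatedPairs m n).measure_preimage hms.compl.nullMeasurableSet]
  refine ENNReal.ofReal_le_of_le_toReal ?_
  change _ ≤ Measure.real _ _
  rw [measureReal_compl hms]
  rw [probReal_univ]
  linarith

end UniformBound

end SRUB

/-- Gaussian rank-one sensing maps satisfy the SRUB property of order `2kr`
with high probability, given `m > C·n·r` samples. -/
theorem gaussian_srub (k : ℕ) (hk : 2 ≤ k) (C₁ C₂ : ℝ)
    (hC₁ : 0 < C₁) (hC₁' : C₁ < 1 / 3) (hC₂ : 1 < C₂) :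
    ∃ C δ : ℝ, 0 < C ∧ 0 < δ ∧
      ∀ (n r m : ℕ), 1 ≤ n → 1 ≤ r → C * n * r < m →
        ENNReal.ofReal (1 - Real.exp (-(m : ℝ) * δ)) ≤
          Measure.pi (fun _ : Fin m =>
              Measure.pi (fun _ : Fin n => ProbabilityTheory.gaussianReal 0 1))
            {z | HasSRUB z (2 * k * r) C₁ C₂} := by
  obtain ⟨ε, hε, hε', hle₂, hle₁⟩ := exists_net_parameter hC₁' hC₂
  have hL : 0 ≤ Real.log (1 + 2 / ε) := Real.log_nonneg (by
    have : 0 ≤ 2 / ε := by positivity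
    linarith)
  set L := Real.log (1 + 2 / ε) with hLdef
  set c := ε ^ 2 / 512 with hc
  have hc0 : 0 < c := by positivity
  refine ⟨max 2 ((4 * k * L + 1) * 8 / c), c / 8, by positivity, by positivity, ?_⟩
  intro n r m hn hr hm
  have hnr : (1 : ℝ) ≤ n * r := by exact_mod_cast Nat.mul_pos hn hr
  rw [mul_assoc] at hm
  have hm2 : (2 : ℝ) < m := by
    nlinarith [le_max_left (2 : ℝ) ((4 * k * L + 1) * 8 / c)]
  have hmc : (4 * k * L + 1) * 8 * (n * r) < m * c := by
    have : (4 * k * L + 1) * 8 / c * (n * r) < m :=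
      lt_of_le_of_lt (by gcongr; exact le_max_right _ _) hm
    rwa [div_mul_eq_mul_div, div_lt_iff₀ hc0] at this
  have hm2' : 2 < m := by exact_mod_cast hm2
  have hM : (m : ℝ) ≤ 4 * (m / 2 : ℕ) := by
    have : m ≤ 4 * (m / 2) := by omega
    exact_mod_cast this
  refine le_trans (ENNReal.ofReal_le_ofReal ?_)
    (ofReal_le_measure_hasSRUB hm2'.le hε hε' hle₁ hle₂)
  gcongr
  rw [← hLdef, ← hc]
  push_cast
  nlinarith [mul_le_mul_of_nonneg_right hM hc0.le]

end
end
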